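/- arXiv:2311.05737 — 2 statements merged into one kernel-verified Lean document; each statement's English description precedes it below -/
import Mathlib

section
/- Let Φ be a root system and α, β, γ ∈ Φ⁺. Then there exists a full root subsystem F ⊆ Φ containing {α, β, γ} of rank at most 3. -/
open Set

variable {V : Type*} [AddCommGroup V] [Module ℝ V]

/-- The set of nonnegative linear combinations of elements of `A`. -/
def posSpan (A : Set V) : Set V :=
  {v | ∃ (s : Finset V) (c : V → ℝ),
    (↑s : Set V) ⊆ A ∧ (∀ x ∈ s, 0 ≤ c x) ∧ v = ∑ x ∈ s, c x • x}

/-- The nonnegative span of the pair `α, β`. -/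
def cone2 (α β : V) : Set V := {v | ∃ a b : ℝ, 0 ≤ a ∧ 0 ≤ b ∧ v = a • α + b • β}

/-- `B` is closed in `X`. -/
def IsClosedIn (X B : Set V) : Prop :=
  B ⊆ X ∧ ∀ α ∈ B, ∀ β ∈ B, ∀ γ ∈ X, γ ∈ cone2 α β → γ ∈ B

/-- `B` is coclosed in `X`. -/
def IsCoclosedIn (X B : Set V) : Prop := B ⊆ X ∧ IsClosedIn X (X \ B)

/-- `B` is biclosed in `X`. -/
def IsBiclosedIn (X B : Set V) : Prop := IsClosedIn X B ∧ IsClosedIn X (X \ B)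

/-- `B` is convex in `X`. -/
def IsConvexIn (X B : Set V) : Prop := B ⊆ X ∧ posSpan B ∩ X = B

/-- `B` is biconvex in `X`. -/
def IsBiconvexIn (X B : Set V) : Prop := IsConvexIn X B ∧ IsConvexIn X (X \ B)

/-- `B` is weakly separable in `X`. -/
def WeaklySeparableIn (X B : Set V) : Prop :=
  B ⊆ X ∧ posSpan B ∩ posSpan (X \ B) = {0}

/-- `B` is separable in `X`. -/
def SeparableIn (X B : Set V) : Prop :=
  B ⊆ X ∧ ∃ θ : Module.Dual ℝ V, (∀ α ∈ B, θ α < 0) ∧ (∀ α ∈ X \ B, 0 < θ α)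

/-- `X` is clean: every biclosed subset is weakly separable. -/
def IsCleanIn (X : Set V) : Prop := ∀ B : Set V, IsBiclosedIn X B → WeaklySeparableIn X B

/-- The closure of `U` in `X`: the smallest closed subset of `X` containing `U`. -/
def closureIn (X U : Set V) : Set V := ⋂₀ {C | U ⊆ C ∧ IsClosedIn X C}

/-- The interior of `K` in `X`. -/
def interiorIn (X K : Set V) : Set V := X \ closureIn X (X \ K)

/-- `F` is a full subset of `X`. -/
def IsFullIn (X F : Set V) : Prop :=
  F ⊆ X ∧ ∀ α ∈ F, ∀ β ∈ F, X ∩ (Submodule.span ℝ {α, β} : Set V) ⊆ F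

/-- A (symmetrizable, crystallographic, real, reduced) root system with a chosen base. -/
structure RootSystemData (V : Type*) [AddCommGroup V] [Module ℝ V] where
  form : V →ₗ[ℝ] V →ₗ[ℝ] ℝ
  symm : ∀ x y : V, form x y = form y x
  Φ : Set V
  base : Set V
  base_sub : base ⊆ Φ
  pos_self : ∀ α ∈ Φ, 0 < form α α
  refl_mem : ∀ α ∈ Φ, ∀ β ∈ Φ, β - (2 * form α β / form α α) • α ∈ Φ
  reduced : ∀ α ∈ Φ, ∀ r : ℝ, r • α ∈ Φ → r = 1 ∨ r = -1
  pos_neg : ∀ α ∈ Φ, Xor' (α ∈ posSpan base) (-α ∈ posSpan base)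
  base_min : ∀ α ∈ base, α ∉ posSpan (base \ {α})
  cryst : ∀ α ∈ Φ, α ∈ AddSubgroup.closure base

variable {V : Type*} [AddCommGroup V] [Module ℝ V]

/-- The positive roots. -/
def RootSystemData.pos (R : RootSystemData V) : Set V := R.Φ ∩ posSpan R.base

/-- A root subsystem: a subset closed under the reflections over its own elements. -/
def RootSystemData.IsSubsystem (R : RootSystemData V) (Λ : Set V) : Prop :=
  Λ ⊆ R.Φ ∧ ∀ α ∈ Λ, ∀ β ∈ Λ, β - (2 * R.form α β / R.form α α) • α ∈ Λ

/-- A full subsystem: `F ∩ Span{α,β} = Φ ∩ Span{α,β}` for all `α, β ∈ F`. -/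
def RootSystemData.IsFullSub (R : RootSystemData V) (F : Set V) : Prop :=
  ∀ α ∈ F, ∀ β ∈ F, R.Φ ∩ (Submodule.span ℝ {α, β} : Set V) ⊆ F

/-- The fundamental roots of a subsystem `Λ`: positive roots of `Λ` not expressible as
nonnegative combinations of the other positive roots of `Λ`. -/
def RootSystemData.fund (R : RootSystemData V) (Λ : Set V) : Set V :=
  {γ | γ ∈ Λ ∩ posSpan R.base ∧ γ ∉ posSpan ((Λ ∩ posSpan R.base) \ {γ})}

/-- The root poset: `x ⪯ y` iff `y - x` is a nonnegative combination of base roots. -/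
def rootLE (R : RootSystemData V) (x y : V) : Prop := y - x ∈ posSpan R.base

/-- An order ideal in the root poset of the positive roots. -/
def IsOrderIdealOf (R : RootSystemData V) (I : Set V) : Prop :=
  I ⊆ R.pos ∧ ∀ γ ∈ I, ∀ β ∈ R.pos, rootLE R β γ → β ∈ I


namespace RootCore

variable {E : Type*} [AddCommGroup E] [Module ℝ E]

/-- The reflection in a unit vector. -/
def rf (B : E →ₗ[ℝ] E →ₗ[ℝ] ℝ) (x y : E) : E := y - (2 * B x y) • x

/-- Unit-normalized positive roots `S` in a pointed cone `C`. -/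
structure Sys (B : E →ₗ[ℝ] E →ₗ[ℝ] ℝ) (C S : Set E) : Prop where
  symm : ∀ x y, B x y = B y x
  cadd : ∀ x ∈ C, ∀ y ∈ C, x + y ∈ C
  csmul : ∀ r : ℝ, 0 ≤ r → ∀ x ∈ C, r • x ∈ C
  pt : ∀ x ∈ C, -x ∈ C → x = 0
  sub : S ⊆ C
  unit : ∀ x ∈ S, B x x = 1
  refl : ∀ x ∈ S, ∀ y ∈ S, rf B x y ∈ S ∨ -(rf B x y) ∈ S

/-- Simple roots of the part of the system in the subspace `T`. -/
def Simp (B : E →ₗ[ℝ] E →ₗ[ℝ] ℝ) (S : Set E) (T : Submodule ℝ E) : Set E :=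
  {x | x ∈ S ∧ x ∈ T ∧ ∀ y ∈ S, y ∈ T → y ≠ x → rf B x y ∈ S}

variable {B : E →ₗ[ℝ] E →ₗ[ℝ] ℝ} {C S : Set E} {T : Submodule ℝ E}

theorem rf_mem_T {x y : E} (hx : x ∈ T) (hy : y ∈ T) : rf B x y ∈ T :=
  T.sub_mem hy (T.smul_mem _ hx)

theorem B_rf_rf (hs : ∀ x y, B x y = B y x) {x : E} (hx : B x x = 1) (y z : E) :
    B (rf B x y) (rf B x z) = B y z := by
  simp only [rf, map_sub, map_smul, LinearMap.sub_apply, LinearMap.smul_apply, smul_eq_mul, hx,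
    hs y x]
  ring

theorem rf_rf {x : E} (hx : B x x = 1) (y : E) : rf B x (rf B x y) = y := by
  simp only [rf, map_sub, map_smul, smul_eq_mul, hx]
  module

theorem rf_self {x : E} (hx : B x x = 1) : rf B x x = -x := by
  simp only [rf, hx]; module

theorem rf_neg (x y : E) : rf B x (-y) = - rf B x y := by
  simp only [rf, map_neg]; module

namespace Sys

theorem ne_zero (h : Sys B C S) {x : E} (hx : x ∈ S) : x ≠ 0 := by
  rintro rfl
  have := h.unit _ hx
  simp at this

theorem not_neg (h : Sys B C S) {x : E} (hx : x ∈ S) (hn : -x ∈ C) : False :=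
  h.ne_zero hx (h.pt x (h.sub hx) hn)

theorem obtuse (h : Sys B C S) {x y : E} (hx : x ∈ Simp B S T) (hy : y ∈ Simp B S T) (hxy : x ≠ y) :
    B x y ≤ 0 := by
  by_contra hk
  push Not at hk
  obtain ⟨hxS, hxT, hx'⟩ := hx
  obtain ⟨hyS, hyT, hy'⟩ := hy
  have h1 := hx' y hyS hyT hxy.symm
  have h2 := hy' x hxS hxT hxy
  have hne : rf B x y ≠ y := by
    intro he
    have : (2 * B x y) • x = 0 := by simpa [rf] using he
    rcases smul_eq_zero.1 this with h0 | h0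
    · linarith
    · exact h.ne_zero hxS h0
  have h3 := hy' _ h1 (rf_mem_T hxT hyT) hne
  set k := 2 * B x y with hkd
  have e1 : rf B x y = y - k • x := rfl
  have e2 : rf B y x = x - k • y := by rw [rf, h.symm y x]
  have e3 : rf B y (rf B x y) = (k ^ 2 - 1) • y - k • x := by
    rw [e1, rf]
    have : B y (y - k • x) = 1 - k * (k / 2) := by
      rw [map_sub, map_smul, h.unit y hyS, h.symm y x, smul_eq_mul]
      rw [hkd]; ring
    rw [this]; module
  have hk0 : 0 < k := by positivity
  by_cases hk1 : k ≤ 1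
  · apply h.not_neg h3
    rw [e3]
    have : -((k ^ 2 - 1) • y - k • x) = (1 - k ^ 2) • y + k • x := by module
    rw [this]
    exact h.cadd _ (h.csmul _ (by nlinarith) _ (h.sub hyS)) _ (h.csmul _ hk0.le _ (h.sub hxS))
  · push Not at hk1
    apply h.not_neg h1
    have : -(rf B x y) = (x - k • y) + ((k - 1) • y + (k - 1) • x) := by rw [e1]; module
    rw [this]
    refine h.cadd _ (e2 ▸ h.sub h2) _ (h.cadd _ (h.csmul _ (by linarith) _ (h.sub hyS)) _
      (h.csmul _ (by linarith) _ (h.sub hxS)))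

/-- nonnegative relation -/
theorem nonneg_rel3 (h : Sys B C S) {x y z : E} (hx : x ∈ S) (hy : y ∈ S) (hz : z ∈ S) {p q r : ℝ}
    (hp : 0 ≤ p) (hq : 0 ≤ q) (hr : 0 ≤ r) (e : p • x + q • y + r • z = 0) : p = 0 := by
  have h1 : p • x ∈ C := h.csmul _ hp _ (h.sub hx)
  have h2 : -(p • x) ∈ C := by
    have : -(p • x) = q • y + r • z := by
      rw [neg_eq_iff_add_eq_zero, ← add_assoc]; exact e
    rw [this]
    exact h.cadd _ (h.csmul _ hq _ (h.sub hy)) _ (h.csmul _ hr _ (h.sub hz))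
  rcases smul_eq_zero.1 (h.pt _ h1 h2) with h0 | h0
  · exact h0
  · exact absurd h0 (h.ne_zero hx)

theorem one_pos3 (h : Sys B C S) {x y z : E} (hx : x ∈ S) (hxy : B x y ≤ 0) (hxz : B x z ≤ 0) {p q r : ℝ}
    (hp : 0 < p) (hq : q ≤ 0) (hr : r ≤ 0) (e : p • x + q • y + r • z = 0) : False := by
  have h1 : B x (p • x + q • y + r • z) = 0 := by rw [e]; simp
  simp only [map_add, map_smul, smul_eq_mul, h.unit x hx] at h1
  nlinarith [mul_nonneg_of_nonpos_of_nonpos hq hxy, mul_nonneg_of_nonpos_of_nonpos hr hxz]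

theorem rel3_aux (h : Sys B C S) {x y z : E} (hx : x ∈ S) (hy : y ∈ S) (hz : z ∈ S)
    (hxy : B x y ≤ 0) (hxz : B x z ≤ 0) (hyz : B y z ≤ 0) {p q r : ℝ}
    (e : p • x + q • y + r • z = 0) : p ≤ 0 := by
  by_contra hp
  push Not at hp
  have hyx : B y x ≤ 0 := by rw [h.symm]; exact hxy
  have hzx : B z x ≤ 0 := by rw [h.symm]; exact hxz
  have hzy : B z y ≤ 0 := by rw [h.symm]; exact hyz
  rcases le_or_gt q 0 with hq | hq <;> rcases le_or_gt r 0 with hr | hr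
  · exact h.one_pos3 hx hxy hxz hp hq hr e
  · rcases hq.lt_or_eq with hq | hq
    · refine h.one_pos3 hy hyx hyz (p := -q) (q := -p) (r := -r) (by linarith) (by linarith)
        (by linarith) ?_
      rw [show -q • y + -p • x + -r • z = -(p • x + q • y + r • z) by module, e, neg_zero]
    · exact hp.ne' (h.nonneg_rel3 hx hy hz hp.le hq.ge hr.le e)
  · rcases hr.lt_or_eq with hr | hr
    · refine h.one_pos3 hz hzx hzy (p := -r) (q := -p) (r := -q) (by linarith) (by linarith)
        (by linarith) ?_
      rw [show -r • z + -p • x + -q • y = -(p • x + q • y + r • z) by module, e, neg_zero]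
    · exact hp.ne' (h.nonneg_rel3 hx hy hz hp.le hq.le hr.ge e)
  · exact hp.ne' (h.nonneg_rel3 hx hy hz hp.le hq.le hr.le e)

theorem rel3 (h : Sys B C S) {x y z : E} (hx : x ∈ S) (hy : y ∈ S) (hz : z ∈ S)
    (hxy : B x y ≤ 0) (hxz : B x z ≤ 0) (hyz : B y z ≤ 0) {p q r : ℝ}
    (e : p • x + q • y + r • z = 0) : p = 0 ∧ q = 0 ∧ r = 0 := by
  have hyx : B y x ≤ 0 := by rw [h.symm]; exact hxy
  have hzx : B z x ≤ 0 := by rw [h.symm]; exact hxz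
  have hzy : B z y ≤ 0 := by rw [h.symm]; exact hyz
  have key : ∀ {x y z : E}, x ∈ S → y ∈ S → z ∈ S → B x y ≤ 0 → B x z ≤ 0 → B y z ≤ 0 →
      ∀ {p q r : ℝ}, p • x + q • y + r • z = 0 → p = 0 := by
    intro x y z hx hy hz hxy hxz hyz p q r e
    apply le_antisymm (h.rel3_aux hx hy hz hxy hxz hyz e)
    have := h.rel3_aux hx hy hz hxy hxz hyz (p := -p) (q := -q) (r := -r) (by
      rw [show -p • x + -q • y + -r • z = -(p • x + q • y + r • z) by module, e, neg_zero])
    linarith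
  refine ⟨key hx hy hz hxy hxz hyz e, key hy hx hz hyx hyz hxz (q := p) (r := r) ?_,
    key hz hx hy hzx hzy hxy (q := p) (r := q) ?_⟩
  · rw [← e]; module
  · rw [← e]; module

/-- the sign pattern of a relation among four simple roots -/
theorem rel4_aux (h : Sys B C S) {x y z w : E} (hx : x ∈ S) (hy : y ∈ S) (hz : z ∈ S) (hw : w ∈ S)
    (hxy : B x y ≤ 0) (hxz : B x z ≤ 0) (hxw : B x w ≤ 0) {p q r s : ℝ}
    (hq : q ≤ 0) (hr : r ≤ 0) (hs : s ≤ 0)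
    (e : p • x + q • y + r • z + s • w = 0) : p = 0 ∧ q = 0 ∧ r = 0 ∧ s = 0 := by
  have key : ∀ {x y z w : E}, x ∈ S → y ∈ S → z ∈ S → w ∈ S → ∀ {p q r s : ℝ}, 
      p ≤ 0 → q ≤ 0 → r ≤ 0 → s ≤ 0 → p • x + q • y + r • z + s • w = 0 → p = 0 := by
    intro x y z w hx hy hz hw p q r s hp hq hr hs e
    have h1 : (-p) • x ∈ C := h.csmul _ (by linarith) _ (h.sub hx)
    have h2 : -((-p) • x) ∈ C := by
      have : -((-p) • x) = (-q) • y + (-r) • z + (-s) • w := by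
        rw [← sub_eq_zero, ← e]; module
      rw [this]
      exact h.cadd _ (h.cadd _ (h.csmul _ (by linarith) _ (h.sub hy)) _
        (h.csmul _ (by linarith) _ (h.sub hz))) _ (h.csmul _ (by linarith) _ (h.sub hw))
    rcases smul_eq_zero.1 (h.pt _ h1 h2) with h0 | h0
    · linarith
    · exact absurd h0 (h.ne_zero hx)
  have hp : p ≤ 0 := by
    by_contra hp
    push Not at hp
    have h1 : B x (p • x + q • y + r • z + s • w) = 0 := by rw [e]; simp
    simp only [map_add, map_smul, smul_eq_mul, h.unit x hx] at h1
    nlinarith [mul_nonneg_of_nonpos_of_nonpos hq hxy, mul_nonneg_of_nonpos_of_nonpos hr hxz,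
      mul_nonneg_of_nonpos_of_nonpos hs hxw]
  refine ⟨key hx hy hz hw hp hq hr hs e, key hy hx hz hw hq hp hr hs ?_,
    key hz hx hy hw hr hp hq hs ?_, key hw hx hy hz hs hp hq hr ?_⟩
  all_goals rw [← e]; module

/-- four simple roots in a space of dimension at most three give a crossing relation -/
theorem rel4 (h : Sys B C S) {x y z w : E} (hx : x ∈ Simp B S T) (hy : y ∈ Simp B S T) (hz : z ∈ Simp B S T)
    (hw : w ∈ Simp B S T) (hxy : x ≠ y) (hxz : x ≠ z) (hxw : x ≠ w) (hyz : y ≠ z) (hyw : y ≠ w)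
    (hzw : z ≠ w) {p q r s : ℝ} (h0 : ¬ (p = 0 ∧ q = 0 ∧ r = 0 ∧ s = 0))
    (e : p • x + q • y + r • z + s • w = 0) :
    ∃ a ∈ Simp B S T, ∃ b ∈ Simp B S T, ∃ c ∈ Simp B S T, ∃ d ∈ Simp B S T,
      a ≠ b ∧ a ≠ c ∧ a ≠ d ∧ b ≠ c ∧ b ≠ d ∧ c ≠ d ∧
      ∃ l m n o : ℝ, 0 < l ∧ 0 < m ∧ 0 < n ∧ 0 < o ∧ l • a + m • c = n • b + o • d := by
  have O : ∀ {x y}, x ∈ Simp B S T → y ∈ Simp B S T → x ≠ y → B x y ≤ 0 :=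
    fun hx hy hxy => h.obtuse hx hy hxy
  -- `key`: at most one positive coefficient is impossible
  have key : ∀ {x y z w : E}, x ∈ Simp B S T → y ∈ Simp B S T → z ∈ Simp B S T →
      w ∈ Simp B S T → x ≠ y → x ≠ z → x ≠ w → ∀ {p q r s : ℝ}, q ≤ 0 → r ≤ 0 → s ≤ 0 →
      p • x + q • y + r • z + s • w = 0 → p = 0 ∧ q = 0 ∧ r = 0 ∧ s = 0 :=
    fun hx hy hz hw hxy hxz hxw _ _ _ _ hq hr hs e =>
      h.rel4_aux hx.1 hy.1 hz.1 hw.1 (O hx hy hxy) (O hx hz hxz) (O hx hw hxw) hq hr hs e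
  -- all three others nonneg
  have key' : ∀ {x y z w : E}, x ∈ Simp B S T → y ∈ Simp B S T → z ∈ Simp B S T →
      w ∈ Simp B S T → x ≠ y → x ≠ z → x ≠ w → ∀ {p q r s : ℝ}, 0 ≤ q → 0 ≤ r → 0 ≤ s →
      p • x + q • y + r • z + s • w = 0 → p = 0 ∧ q = 0 ∧ r = 0 ∧ s = 0 := by
    intro x y z w hx hy hz hw hxy hxz hxw p q r s hq hr hs e
    have := key hx hy hz hw hxy hxz hxw (p := -p) (q := -q) (r := -r) (s := -s)
      (by linarith) (by linarith) (by linarith) (by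
        rw [show -p • x + -q • y + -r • z + -s • w = -(p • x + q • y + r • z + s • w) by module,
          e, neg_zero])
    simpa using this
  -- the generic two-two case
  have two : ∀ {x y z w : E}, x ∈ Simp B S T → y ∈ Simp B S T → z ∈ Simp B S T →
      w ∈ Simp B S T → x ≠ y → x ≠ z → x ≠ w → y ≠ z → y ≠ w → z ≠ w →
      ∀ {p q r s : ℝ}, 0 < p → 0 < q → r ≤ 0 → s ≤ 0 →
      p • x + q • y + r • z + s • w = 0 → 
      ∃ a ∈ Simp B S T, ∃ b ∈ Simp B S T, ∃ c ∈ Simp B S T, ∃ d ∈ Simp B S T,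
      a ≠ b ∧ a ≠ c ∧ a ≠ d ∧ b ≠ c ∧ b ≠ d ∧ c ≠ d ∧
      ∃ l m n o : ℝ, 0 < l ∧ 0 < m ∧ 0 < n ∧ 0 < o ∧ l • a + m • c = n • b + o • d := by
    intro x y z w hx hy hz hw hxy hxz hxw hyz hyw hzw p q r s hp hq hr hs e
    have hr' : r < 0 := by
      rcases hr.lt_or_eq with hr | hr
      · exact hr
      · have := key' hw hx hy hz hxw.symm hyw.symm hzw.symm (p := s) hp.le hq.le hr.ge
          (by rw [← e]; module)
        linarith [this.2.1]
    have hs' : s < 0 := by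
      rcases hs.lt_or_eq with hs | hs
      · exact hs
      · have := key' hz hx hy hw hxz.symm hyz.symm hzw (p := r) hp.le hq.le hs.ge
          (by rw [← e]; module)
        linarith [this.2.1]
    refine ⟨x, hx, z, hz, y, hy, w, hw, hxz, hxy, hxw, hyz.symm, hzw, hyw, p, q, -r, -s, hp, hq,
      by linarith, by linarith, ?_⟩
    rw [← sub_eq_zero, ← e]; module
  rcases le_or_gt p 0 with hp | hp <;> rcases le_or_gt q 0 with hq | hq <;>
    rcases le_or_gt r 0 with hr | hr <;> rcases le_or_gt s 0 with hs | hs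
  · exact absurd (key hx hy hz hw hxy hxz hxw hq hr hs e) h0
  · have := key hw hx hy hz hxw.symm hyw.symm hzw.symm (p := s) hp hq hr (by rw [← e]; module)
    tauto
  · have := key hz hx hy hw hxz.symm hyz.symm hzw (p := r) hp hq hs (by rw [← e]; module)
    tauto
  · exact two hz hw hx hy hzw hxz.symm hyz.symm hxw.symm hyw.symm hxy hr hs hp hq
      (by rw [← e]; module)
  · have := key hy hx hz hw hxy.symm hyz hyw (p := q) hp hr hs (by rw [← e]; module)
    tauto
  · exact two hy hw hx hz hyw hxy.symm hyz hxw.symm hzw.symm hxz hq hs hp hr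
      (by rw [← e]; module)
  · exact two hy hz hx hw hyz hxy.symm hyw hxz.symm hzw hxw hq hr hp hs
      (by rw [← e]; module)
  · exact absurd (key' hx hy hz hw hxy hxz hxw hq.le hr.le hs.le e) h0
  · exact absurd (key hx hy hz hw hxy hxz hxw hq hr hs e) h0
  · exact two hx hw hy hz hxw hxy hxz hyw.symm hzw.symm hyz hp hs hq hr
      (by rw [← e]; module)
  · exact two hx hz hy hw hxz hxy hxw hyz.symm hzw hyw hp hr hq hs
      (by rw [← e]; module)
  · have := key' hy hx hz hw hxy.symm hyz hyw (p := q) hp.le hr.le hs.le (by rw [← e]; module)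
    tauto
  · exact two hx hy hz hw hxy hxz hxw hyz hyw hzw hp hq hr hs e
  · have := key' hz hx hy hw hxz.symm hyz.symm hzw (p := r) hp.le hq.le hs.le
      (by rw [← e]; module)
    tauto
  · have := key' hw hx hy hz hxw.symm hyw.symm hzw.symm (p := s) hp.le hq.le hr.le
      (by rw [← e]; module)
    tauto
  · exact absurd (key' hx hy hz hw hxy hxz hxw hq.le hr.le hs.le e) h0

end Sys
end RootCore

namespace RootCore

variable {E : Type*} [AddCommGroup E] [Module ℝ E]
variable {B : E →ₗ[ℝ] E →ₗ[ℝ] ℝ} {C S : Set E} {a b c d : E} {l m n o : ℝ}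

/-- Four simple roots with a crossing relation, spanning the space. -/
structure Quad (B : E →ₗ[ℝ] E →ₗ[ℝ] ℝ) (S : Set E) (a b c d : E) (l m n o : ℝ) : Prop where
  ha : a ∈ Simp B S ⊤
  hb : b ∈ Simp B S ⊤
  hc : c ∈ Simp B S ⊤
  hd : d ∈ Simp B S ⊤
  ab : a ≠ b
  ac : a ≠ c
  ad : a ≠ d
  bc : b ≠ c
  bd : b ≠ d
  cd : c ≠ d
  l0 : 0 < l
  m0 : 0 < m
  n0 : 0 < n
  o0 : 0 < o
  rel : l • a + m • c = n • b + o • d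
  span : ∀ u, ∃ p q r s : ℝ, u = p • a + q • b + r • c + s • d

namespace Quad

theorem swapAC (Q : Quad B S a b c d l m n o) : Quad B S c b a d m l n o where
  ha := Q.hc
  hb := Q.hb
  hc := Q.ha
  hd := Q.hd
  ab := Q.bc.symm
  ac := Q.ac.symm
  ad := Q.cd
  bc := Q.ab.symm
  bd := Q.bd
  cd := Q.ad
  l0 := Q.m0
  m0 := Q.l0
  n0 := Q.n0
  o0 := Q.o0
  rel := by rw [add_comm]; exact Q.rel
  span := fun u => by
    obtain ⟨p, q, r, s, h⟩ := Q.span u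
    exact ⟨r, q, p, s, by rw [h]; abel⟩

theorem rot (Q : Quad B S a b c d l m n o) : Quad B S b a d c n o l m where
  ha := Q.hb
  hb := Q.ha
  hc := Q.hd
  hd := Q.hc
  ab := Q.ab.symm
  ac := Q.bd
  ad := Q.bc
  bc := Q.ad
  bd := Q.ac
  cd := Q.cd.symm
  l0 := Q.n0
  m0 := Q.o0
  n0 := Q.l0
  o0 := Q.m0
  rel := Q.rel.symm
  span := fun u => by
    obtain ⟨p, q, r, s, h⟩ := Q.span u
    exact ⟨q, p, s, r, by rw [h]; abel⟩

theorem swapBD (Q : Quad B S a b c d l m n o) : Quad B S a d c b l m o n :=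
  Q.rot.swapAC.rot

theorem span3 (Q : Quad B S a b c d l m n o) (u : E) :
    ∃ p q r : ℝ, u = p • a + q • b + r • c := by
  obtain ⟨p, q, r, s, h⟩ := Q.span u
  have hd : d = o⁻¹ • (l • a + m • c - n • b) := by
    rw [Q.rel, add_sub_cancel_left, smul_smul, inv_mul_cancel₀ Q.o0.ne', one_smul]
  refine ⟨p + s * o⁻¹ * l, q - s * o⁻¹ * n, r + s * o⁻¹ * m, ?_⟩
  rw [h, hd]; module

theorem spanv (Q : Quad B S a b c d l m n o) (u : E) :
    ∃ p q r : ℝ, u = p • a + q • b + r • (l • a + m • c) := by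
  obtain ⟨p, q, r, h⟩ := Q.span3 u
  refine ⟨p - r * m⁻¹ * l, q, r * m⁻¹, ?_⟩
  have : (r * m⁻¹) * m = r := by rw [mul_assoc, inv_mul_cancel₀ Q.m0.ne', mul_one]
  rw [h, smul_add, smul_smul, smul_smul, this]; module

theorem exists_dual (h : Sys B C S) (Q : Quad B S a b c d l m n o) :
    ∃ θ : E →ₗ[ℝ] ℝ, (∀ x ∈ S, 0 ≤ θ x) ∧ θ ≠ 0 := by
  have Ca := h.sub Q.ha.1
  have Cb := h.sub Q.hb.1
  have Cc := h.sub Q.hc.1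
  have Cd := h.sub Q.hd.1
  have C0 : (0 : E) ∈ C := by simpa using h.csmul 0 le_rfl a Ca
  let K : PointedCone ℝ E :=
    { carrier := C
      add_mem' := fun {x y} hx hy => h.cadd x hx y hy
      zero_mem' := C0
      smul_mem' := fun r x hx => h.csmul r r.2 x hx }
  set w := a + b + c + d with hw
  have hw0 : w ≠ 0 := by
    intro e
    have := h.rel4_aux (p := -1) (q := -1) (r := -1) (s := -1) Q.ha.1 Q.hb.1 Q.hc.1 Q.hd.1
      (h.obtuse Q.ha Q.hb Q.ab) (h.obtuse Q.ha Q.hc Q.ac) (h.obtuse Q.ha Q.hd Q.ad)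
      (by norm_num) (by norm_num) (by norm_num) (by
        rw [show (-1:ℝ) • a + (-1:ℝ) • b + (-1:ℝ) • c + (-1:ℝ) • d = -w by rw [hw]; module, e,
          neg_zero])
    norm_num at this
  have Cw : w ∈ C := h.cadd _ (h.cadd _ (h.cadd _ Ca _ Cb) _ Cc) _ Cd
  obtain ⟨g, hg1, hg2⟩ := riesz_extension K (LinearPMap.mkSpanSingleton (K := ℝ) w (1:ℝ) hw0) (by
      rintro ⟨x, hx⟩ hxC
      obtain ⟨t, rfl⟩ := Submodule.mem_span_singleton.1 hx
      have ev := LinearPMap.mkSpanSingleton'_apply (σ := RingHom.id ℝ) w (1:ℝ)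
        (fun c hc => by simp [(smul_eq_zero.1 hc).resolve_right hw0]) t hx
      refine le_of_le_of_eq ?_ ev.symm
      simp only [smul_eq_mul, mul_one, RingHom.id_apply]
      by_contra ht
      push Not at ht
      have h1 : -(t • w) ∈ C := by
        rw [← neg_smul]; exact h.csmul _ (by linarith) _ Cw
      rcases smul_eq_zero.1 (h.pt _ hxC h1) with h0 | h0
      · linarith
      · exact hw0 h0) (by
      intro y
      obtain ⟨p, q, r, s, hy⟩ := Q.span y
      refine ⟨⟨(|p| + |q| + |r| + |s|) • w, Submodule.mem_span_singleton.2 ⟨_, rfl⟩⟩, ?_⟩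
      change (|p| + |q| + |r| + |s|) • w + y ∈ C
      have hp := abs_nonneg p
      have hq := abs_nonneg q
      have hr := abs_nonneg r
      have hs := abs_nonneg s
      have hp' := neg_abs_le p
      have hq' := neg_abs_le q
      have hr' := neg_abs_le r
      have hs' := neg_abs_le s
      have : (|p| + |q| + |r| + |s|) • w + y =
        (|p| + |q| + |r| + |s| + p) • a + (|p| + |q| + |r| + |s| + q) • b
        + (|p| + |q| + |r| + |s| + r) • c + (|p| + |q| + |r| + |s| + s) • d := by
        rw [hy, hw]; module
      rw [this]
      refine h.cadd _ (h.cadd _ (h.cadd _ (h.csmul _ ?_ _ Ca) _ (h.csmul _ ?_ _ Cb)) _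
        (h.csmul _ ?_ _ Cc)) _ (h.csmul _ ?_ _ Cd) <;> linarith)
  refine ⟨g, fun x hx => hg2 x (h.sub hx), ?_⟩
  rintro rfl
  have := hg1 ⟨w, Submodule.mem_span_singleton_self w⟩
  rw [LinearPMap.mkSpanSingleton_apply] at this
  simp at this

/-- `ℓ` is killed by the dual cone -/
def InL (S : Set E) (ℓ : E) : Prop := ∀ θ : E →ₗ[ℝ] ℝ, (∀ x ∈ S, 0 ≤ θ x) → θ ℓ = 0

theorem dich (h : Sys B C S) {x : E} (hx : x ∈ Simp B S ⊤) (hxL : ¬ InL S x) {ℓ : E}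
    (hℓ : InL S ℓ) : B x ℓ = 0 := by
  unfold InL at hxL
  push Not at hxL
  obtain ⟨θ, hθ, hθx⟩ := hxL
  have := hℓ (2 • θ - (2 * θ x) • B x) (by
    intro y hy
    simp only [LinearMap.sub_apply, LinearMap.smul_apply, smul_eq_mul, nsmul_eq_mul]
    by_cases hyx : y = x
    · rw [hyx, h.unit x hx.1]; push_cast; linarith
    · have h1 := hθ _ (hx.2.2 y hy trivial hyx)
      simp only [rf, map_sub, map_smul, smul_eq_mul] at h1
      have := hθ y hy
      push_cast; linarith)
  simp only [LinearMap.sub_apply, LinearMap.smul_apply, smul_eq_mul, nsmul_eq_mul, hℓ θ hθ] at this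
  have h2 : θ x * B x ℓ = 0 := by push_cast at this; linarith
  exact (mul_eq_zero.1 h2).resolve_left hθx

theorem not_both (h : Sys B C S) (Q : Quad B S a b c d l m n o) (ha : InL S a) (hc : InL S c) :
    False := by
  obtain ⟨θ, hθ, hθ0⟩ := Q.exists_dual h
  apply hθ0
  have e := congrArg θ Q.rel
  simp only [map_add, map_smul, smul_eq_mul, ha θ hθ, hc θ hθ] at e
  have hb := hθ b Q.hb.1
  have hd := hθ d Q.hd.1
  have hb' : θ b = 0 := by
    have := mul_nonneg Q.n0.le hb
    have := mul_nonneg Q.o0.le hd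
    have h3 : n * θ b = 0 := by linarith
    exact (mul_eq_zero.1 h3).resolve_left Q.n0.ne'
  ext u
  obtain ⟨p, q, r, hu⟩ := Q.span3 u
  simp [hu, ha θ hθ, hc θ hθ, hb']

theorem not_adj (h : Sys B C S) (Q : Quad B S a b c d l m n o) (ha : InL S a) (hb : InL S b) :
    False := by
  have hc : ¬ InL S c := fun hc => Q.not_both h ha hc
  have hd : ¬ InL S d := fun hd => Q.rot.not_both h hb hd
  have e := congrArg (B c) Q.rel
  simp only [map_add, map_smul, smul_eq_mul, dich h Q.hc hc ha, dich h Q.hc hc hb,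
    h.unit c Q.hc.1] at e
  have := h.obtuse Q.hc Q.hd Q.cd
  have := Q.m0
  nlinarith [Q.o0]

theorem not_a (h : Sys B C S) (Q : Quad B S a b c d l m n o) : ¬ InL S a := by
  intro ha
  have hb : ¬ InL S b := fun hb => Q.not_adj h ha hb
  have hc : ¬ InL S c := fun hc => Q.not_both h ha hc
  have hd : ¬ InL S d := fun hd => Q.swapBD.not_adj h ha hd
  have e := congrArg (B a) Q.rel
  simp only [map_add, map_smul, smul_eq_mul, h.symm a b, h.symm a c, h.symm a d,
    dich h Q.hc hc ha, dich h Q.hb hb ha, dich h Q.hd hd ha, h.unit a Q.ha.1] at e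
  have := Q.l0
  linarith

theorem L_zero (h : Sys B C S) (Q : Quad B S a b c d l m n o) {ℓ : E} (hℓ : InL S ℓ) : ℓ = 0 := by
  have na := Q.not_a h
  have nb := Q.rot.not_a h
  have nc := Q.swapAC.not_a h
  have key : ∀ {ℓ : E}, InL S ℓ → ∀ {p q r : ℝ}, 0 ≤ p → 0 ≤ q → 0 ≤ r →
      ℓ = p • a + q • b + r • c → ℓ = 0 := by
    intro ℓ hℓ p q r hp hq hr e
    have aux : ∀ θ : E →ₗ[ℝ] ℝ, (∀ x ∈ S, 0 ≤ θ x) → p * θ a = 0 ∧ q * θ b = 0 ∧ r * θ c = 0 := by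
      intro θ hθ
      have h0 := hℓ θ hθ
      rw [e] at h0
      simp only [map_add, map_smul, smul_eq_mul] at h0
      have := mul_nonneg hp (hθ a Q.ha.1)
      have := mul_nonneg hq (hθ b Q.hb.1)
      have := mul_nonneg hr (hθ c Q.hc.1)
      refine ⟨?_, ?_, ?_⟩ <;> linarith
    have hp0 : p = 0 := by
      by_contra hp0
      exact na fun θ hθ => (mul_eq_zero.1 (aux θ hθ).1).resolve_left hp0
    have hq0 : q = 0 := by
      by_contra hp0
      exact nb fun θ hθ => (mul_eq_zero.1 (aux θ hθ).2.1).resolve_left hp0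
    have hr0 : r = 0 := by
      by_contra hp0
      exact nc fun θ hθ => (mul_eq_zero.1 (aux θ hθ).2.2).resolve_left hp0
    rw [e, hp0, hq0, hr0]; simp
  have neg : ∀ {ℓ : E}, InL S ℓ → InL S (-ℓ) := fun hℓ θ hθ => by rw [map_neg, hℓ θ hθ, neg_zero]
  have one : ∀ {x y z : E}, x ∈ Simp B S ⊤ → ¬ InL S x → B x y ≤ 0 → B x z ≤ 0 →
      ∀ {ℓ : E}, InL S ℓ → ∀ {p q r : ℝ}, 0 < p → q ≤ 0 → r ≤ 0 →
      ℓ = p • x + q • y + r • z → False := by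
    intro x y z hx hxL hxy hxz ℓ hℓ p q r hp hq hr e
    have h1 := dich h hx hxL hℓ
    rw [e] at h1
    simp only [map_add, map_smul, smul_eq_mul, h.unit x hx.1] at h1
    nlinarith [mul_nonneg_of_nonpos_of_nonpos hq hxy, mul_nonneg_of_nonpos_of_nonpos hr hxz]
  have oab := h.obtuse Q.ha Q.hb Q.ab
  have oac := h.obtuse Q.ha Q.hc Q.ac
  have obc := h.obtuse Q.hb Q.hc Q.bc
  have oba := oab
  have oca := oac
  have ocb := obc
  rw [h.symm] at oba oca ocb
  -- main claim: if p > 0 then all are nonneg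
  have main : ∀ {ℓ : E}, InL S ℓ → ∀ {x y z : E}, x ∈ Simp B S ⊤ → y ∈ Simp B S ⊤ →
      z ∈ Simp B S ⊤ → ¬ InL S x → ¬ InL S y → ¬ InL S z → B x y ≤ 0 → B x z ≤ 0 → B y z ≤ 0 →
      ∀ {p q r : ℝ}, 0 < p → ℓ = p • x + q • y + r • z → 0 ≤ q ∧ 0 ≤ r := by
    intro ℓ hℓ x y z hx hy hz nx ny nz hxy hxz hyz p q r hp e
    rcases le_or_gt 0 q with hq | hq <;> rcases le_or_gt 0 r with hr | hr
    · exact ⟨hq, hr⟩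
    · exact (one hz nz (by rwa [h.symm]) (by rwa [h.symm]) (neg hℓ) (p := -r) (q := -p) (r := -q)
        (y := x) (z := y) (by linarith) (by linarith) (by linarith) (by rw [e]; module)).elim
    · exact (one hy ny (by rwa [h.symm]) hyz (neg hℓ) (p := -q) (q := -p) (r := -r)
        (y := x) (z := z) (by linarith) (by linarith) (by linarith) (by rw [e]; module)).elim
    · exact (one hx nx hxy hxz hℓ hp hq.le hr.le e).elim
  have fin : ∀ {ℓ : E}, InL S ℓ → ∀ {p q r : ℝ}, 0 < p ∨ 0 < q ∨ 0 < r →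
      ℓ = p • a + q • b + r • c → ℓ = 0 := by
    intro ℓ hℓ p q r h0 e
    rcases h0 with h0 | h0 | h0
    · obtain ⟨h1, h2⟩ := main hℓ Q.ha Q.hb Q.hc na nb nc oab oac obc h0 e
      exact key hℓ h0.le h1 h2 e
    · obtain ⟨h1, h2⟩ := main hℓ Q.hb Q.ha Q.hc nb na nc oba obc oac h0
        (show ℓ = q • b + p • a + r • c by rw [e]; module)
      exact key hℓ h1 h0.le h2 e
    · obtain ⟨h1, h2⟩ := main hℓ Q.hc Q.ha Q.hb nc na nb oca ocb oab h0
        (show ℓ = r • c + p • a + q • b by rw [e]; module)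
      exact key hℓ h1 h2 h0.le e
  obtain ⟨p, q, r, e⟩ := Q.span3 ℓ
  by_cases h0 : 0 < p ∨ 0 < q ∨ 0 < r
  · exact fin hℓ h0 e
  · push Not at h0
    have := key (neg hℓ) (p := -p) (q := -q) (r := -r) (by linarith [h0.1]) (by linarith [h0.2.1])
      (by linarith [h0.2.2]) (by rw [e]; module)
    simpa using this

theorem exists_pos [FiniteDimensional ℝ E] (h : Sys B C S) (Q : Quad B S a b c d l m n o) :
    ∃ θ : E →ₗ[ℝ] ℝ, ∀ x ∈ S, 0 < θ x := by
  let D : Set (Module.Dual ℝ E) := {θ | ∀ x ∈ S, 0 ≤ θ x}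
  have hD : Submodule.span ℝ D = ⊤ := by
    by_contra hne
    obtain ⟨f, hf0, hf⟩ := Submodule.exists_le_ker_of_lt_top _ (lt_top_iff_ne_top.2 hne)
    obtain ⟨ℓ, rfl⟩ := (Module.evalEquiv ℝ E).surjective f
    apply hf0
    have : ℓ = 0 := Q.L_zero h fun θ hθ => by
      have := hf (Submodule.subset_span (show θ ∈ D from hθ))
      simpa using this
    rw [this, map_zero]
  let bs := Module.Basis.ofSpan hD.ge
  have hbs : ∀ i, bs i ∈ D := fun i => Module.Basis.ofSpan_subset hD.ge ⟨i, rfl⟩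
  have : Finite _ := Module.Finite.finite_basis bs
  have := Fintype.ofFinite (Module.Free.ChooseBasisIndex ℝ E)
  let := Fintype.ofFinite ((linearIndepOn_empty ℝ id).extend (empty_subset D))
  refine ⟨∑ i, bs i, fun x hx => ?_⟩
  rw [LinearMap.sum_apply]
  have hnn : ∀ i ∈ Finset.univ, 0 ≤ bs i x := fun i _ => hbs i x hx
  refine lt_of_le_of_ne (Finset.sum_nonneg hnn) fun h0 => ?_
  have h1 := (Finset.sum_eq_zero_iff_of_nonneg hnn).1 h0.symm
  apply h.ne_zero hx
  rw [← Module.forall_dual_apply_eq_zero_iff ℝ]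
  intro φ
  rw [← bs.sum_repr φ, LinearMap.sum_apply]
  exact Finset.sum_eq_zero fun i _ => by
    rw [LinearMap.smul_apply, h1 i (Finset.mem_univ i), smul_zero]

/-- the functional `-B v` is nonnegative on `S` -/
theorem f_nonneg (h : Sys B C S) (Q : Quad B S a b c d l m n o) {θ : E →ₗ[ℝ] ℝ}
    (hθ : ∀ x ∈ S, 0 < θ x) {ζ : E} (hζ : ζ ∈ S) : B (l • a + m • c) ζ ≤ 0 := by
  by_contra hk
  push Not at hk
  set v := l • a + m • c with hv
  set k := B v ζ with hkd
  have hl := Q.l0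
  have hm := Q.m0
  have hva : B v a ≤ 0 := by
    rw [hv, Q.rel]
    simp only [map_add, map_smul, LinearMap.add_apply, LinearMap.smul_apply, smul_eq_mul]
    nlinarith [Q.n0, Q.o0, h.obtuse Q.hb Q.ha Q.ab.symm, h.obtuse Q.hd Q.ha Q.ad.symm]
  have hvc : B v c ≤ 0 := by
    rw [hv, Q.rel]
    simp only [map_add, map_smul, LinearMap.add_apply, LinearMap.smul_apply, smul_eq_mul]
    nlinarith [Q.n0, Q.o0, h.obtuse Q.hb Q.hc Q.bc, h.obtuse Q.hd Q.hc Q.cd.symm]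
  set c0 := k / (l + m) with hc0
  have hc0p : 0 < c0 := by positivity
  set δ := 2 * c0 * min (θ a) (θ c) with hδ
  have hδp : 0 < δ := by
    have := lt_min (hθ a Q.ha.1) (hθ c Q.hc.1)
    positivity
  have step : ∀ x ∈ Simp B S ⊤, B v x ≤ 0 → min (θ a) (θ c) ≤ θ x → ∀ y ∈ S, k ≤ B v y →
      c0 ≤ B x y → ∃ z ∈ S, k ≤ B v z ∧ θ z ≤ θ y - δ := by
    intro x hx hvx hmin y hy hky hxy
    have hne : y ≠ x := by rintro rfl; linarith
    refine ⟨_, hx.2.2 y hy trivial hne, ?_, ?_⟩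
    · simp only [rf, map_sub, map_smul, smul_eq_mul]
      nlinarith
    · simp only [rf, map_sub, map_smul, smul_eq_mul]
      have h1 : c0 * min (θ a) (θ c) ≤ B x y * θ x := by
        apply mul_le_mul hxy hmin (lt_min (hθ a Q.ha.1) (hθ c Q.hc.1)).le (by linarith)
      rw [hδ]; linarith
  have all : ∀ N : ℕ, ∃ z ∈ S, k ≤ B v z ∧ θ z ≤ θ ζ - N * δ := by
    intro N
    induction N with
    | zero => exact ⟨ζ, hζ, le_rfl, by simp⟩
    | succ N ih =>
      obtain ⟨y, hy, hky, hθy⟩ := ih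
      have h1 : c0 ≤ B a y ∨ c0 ≤ B c y := by
        by_contra hcon
        push Not at hcon
        have : B v y = l * B a y + m * B c y := by
          rw [hv]
          simp only [map_add, map_smul, LinearMap.add_apply, LinearMap.smul_apply, smul_eq_mul]
        have h2 : c0 * (l + m) = k := by rw [hc0]; field_simp
        nlinarith [hcon.1, hcon.2]
      rcases h1 with h1 | h1
      · obtain ⟨z, hz, hz1, hz2⟩ := step a Q.ha hva (min_le_left _ _) y hy hky h1
        exact ⟨z, hz, hz1, by push_cast; linarith⟩
      · obtain ⟨z, hz, hz1, hz2⟩ := step c Q.hc hvc (min_le_right _ _) y hy hky h1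
        exact ⟨z, hz, hz1, by push_cast; linarith⟩
  obtain ⟨N, hN⟩ := exists_nat_gt (θ ζ / δ)
  obtain ⟨z, hz, -, hz2⟩ := all N
  rw [div_lt_iff₀ hδp] at hN
  linarith [hθ z hz]

end Quad
end RootCore

namespace RootCore

section algebra
variable {E : Type*} [AddCommGroup E] [Module ℝ E]
variable {B : E →ₗ[ℝ] E →ₗ[ℝ] ℝ} {C S : Set E} {a b c d : E} {l m n o : ℝ}

/-- Gram determinant estimate -/
theorem gram_aux {A D H N g n o h e : ℝ} (hn : 0 < n) (ho : 0 < o) (hN : 0 < N)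
    (hg : 0 ≤ g) (he : 0 ≤ e)
    (e1 : A = n * g + o * e) (e2 : H = - n - o * h) (e3 : D = - n * h - o)
    (e4 : N = n * H + o * D) :
    (A * H / N - g) ^ 2 < (1 + A ^ 2 / N) * (1 + H ^ 2 / N) := by
  by_cases hs : 0 ≤ A * H / N - g
  · have h1 : (A * H / N - g) ^ 2 ≤ (A * H / N) ^ 2 := by
      apply pow_le_pow_left₀ hs; linarith
    have h2 : (A * H / N) ^ 2 = (A ^ 2 / N) * (H ^ 2 / N) := by field_simp
    have h3 : 0 ≤ A ^ 2 / N := by positivity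
    have h4 : 0 ≤ H ^ 2 / N := by positivity
    nlinarith
  · push Not at hs
    have h0 : g - A * H / N ≤ A * (o * D) / (n * N) := by
      have : A * (o * D) / (n * N) - (g - A * H / N) = (o * e) / n := by
        rw [show o * D = N - n * H by linarith]
        field_simp
        rw [e1]; ring
      have : 0 ≤ (o * e) / n := by positivity
      linarith
    have h1 : (A * H / N - g) ^ 2 ≤ (A * (o * D) / (n * N)) ^ 2 := by
      rw [show (A * H / N - g) ^ 2 = (g - A * H / N) ^ 2 by ring]
      apply pow_le_pow_left₀ (by linarith) h0
    have h2 : (A * (o * D) / (n * N)) ^ 2 = (o / n) ^ 2 * ((A ^ 2 / N) * (D ^ 2 / N)) := by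
      field_simp
    have h5 : 1 + H ^ 2 / N = (o / n) ^ 2 * (1 + D ^ 2 / N) := by
      have hN' : N ≠ 0 := hN.ne'
      have : n ^ 2 * (N + H ^ 2) = o ^ 2 * (N + D ^ 2) := by
        rw [e4, e2, e3]; ring
      field_simp
      linarith
    have h3 : 0 ≤ A ^ 2 / N := by positivity
    have h4 : 0 ≤ D ^ 2 / N := by positivity
    have h6 : 0 < (o / n) ^ 2 := by positivity
    rw [h5]
    calc _ ≤ _ := h1
      _ = _ := h2
      _ < (o / n) ^ 2 * ((1 + A ^ 2 / N) * (1 + D ^ 2 / N)) := by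
        apply mul_lt_mul_of_pos_left _ h6
        nlinarith
      _ = _ := by ring

theorem quad_pos {P R Q x y : ℝ} (hP : 0 < P) (hd : R ^ 2 < P * Q) (h0 : ¬ (x = 0 ∧ y = 0)) :
    0 < P * x ^ 2 + 2 * R * (x * y) + Q * y ^ 2 := by
  have e : P * (P * x ^ 2 + 2 * R * (x * y) + Q * y ^ 2)
      = (P * x + R * y) ^ 2 + (P * Q - R ^ 2) * y ^ 2 := by ring
  have h1 : 0 < P * (P * x ^ 2 + 2 * R * (x * y) + Q * y ^ 2) := by
    rw [e]
    by_cases hy : y = 0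
    · have hx : x ≠ 0 := fun hx => h0 ⟨hx, hy⟩
      rw [hy]; simp; positivity
    · have : 0 < (P * Q - R ^ 2) * y ^ 2 := mul_pos (by linarith) (by positivity)
      have := sq_nonneg (P * x + R * y)
      linarith
  exact pos_of_mul_pos_right h1 hP.le

/-- dichotomy: either `θ` works directly or `-B v` does. -/
theorem Quad.posdef (h : Sys B C S) (Q : Quad B S a b c d l m n o) {θ : E →ₗ[ℝ] ℝ}
    (hθ : ∀ x ∈ S, 0 < θ x) :
    (∀ u, u ≠ 0 → 0 < B u u + θ u ^ 2) ∨
    ∃ K : ℝ, 0 < K ∧ ∀ u, u ≠ 0 → 0 < B u u + K * (B (l • a + m • c) u) ^ 2 := by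
  have hfa := Q.f_nonneg h hθ Q.ha.1
  have hfb := Q.f_nonneg h hθ Q.hb.1
  have hfc := Q.f_nonneg h hθ Q.hc.1
  have hfd := Q.f_nonneg h hθ Q.hd.1
  set v := l • a + m • c with hv
  have hl := Q.l0
  have hm := Q.m0
  have hn := Q.n0
  have ho := Q.o0
  have oab := h.obtuse Q.ha Q.hb Q.ab
  have oad := h.obtuse Q.ha Q.hd Q.ad
  have obc := h.obtuse Q.hb Q.hc Q.bc
  have ocd := h.obtuse Q.hc Q.hd Q.cd
  have hrel : v = n • b + o • d := Q.rel
  have va : B v a = n * B a b + o * B a d := by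
    rw [hrel]; simp [h.symm b a, h.symm d a]
  have vb : B v b = n + o * B b d := by
    rw [hrel]; simp [h.unit b Q.hb.1, h.symm d b]
  have vd : B v d = n * B b d + o := by
    rw [hrel]; simp [h.unit d Q.hd.1]
  have vb' : B v b = l * B a b + m * B b c := by
    rw [hv]; simp [h.symm c b]
  have vv : B v v = n * B v b + o * B v d := by
    nth_rw 2 [hrel]; simp
  have vv' : B v v = l * B v a + m * B v c := by
    nth_rw 2 [hv]; simp
  have vc : B v c = n * B b c + o * B c d := by
    rw [hrel]; simp [h.symm d c]
  have hBu : ∀ x y z : ℝ, B (x • a + y • b + z • v) (x • a + y • b + z • v)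
      = x ^ 2 + y ^ 2 + 2 * (x * y) * B a b + 2 * z * (x * B v a + y * B v b) + z ^ 2 * B v v := by
    intro x y z
    simp only [map_add, map_smul, LinearMap.add_apply, LinearMap.smul_apply, smul_eq_mul,
      h.unit a Q.ha.1, h.unit b Q.hb.1, h.symm b a, h.symm a v, h.symm b v]
    ring
  have hvu : ∀ x y z : ℝ, B v (x • a + y • b + z • v) = x * B v a + y * B v b + z * B v v := by
    intro x y z
    simp only [map_add, map_smul, smul_eq_mul]
  have hN0 : B v v ≤ 0 := by
    rw [vv]; nlinarith
  rcases hN0.lt_or_eq with hN | hN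
  · right
    have gram := gram_aux (A := - B v a) (D := - B v d) (H := - B v b) (N := - B v v)
      (g := - B a b) (n := n) (o := o) (h := B b d) (e := - B a d) hn ho (by linarith)
      (by linarith) (by linarith)
      (by rw [va]; ring) (by rw [vb]; ring) (by rw [vd]; ring) (by rw [vv]; ring)
    set N := - B v v with hNd
    have hNp : 0 < N := by linarith
    refine ⟨2 / N, by positivity, fun u hu => ?_⟩
    obtain ⟨x, y, z, rfl⟩ := Q.spanv u
    rw [← hv] at hu ⊢
    rw [hBu, hvu]
    set A := - B v a with hA
    set H := - B v b with hH
    set g := - B a b with hg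
    have key : x ^ 2 + y ^ 2 + 2 * (x * y) * B a b + 2 * z * (x * B v a + y * B v b) + z ^ 2 * B v v
        + 2 / N * (x * B v a + y * B v b + z * B v v) ^ 2 =
        ((1 + A ^ 2 / N) * x ^ 2 + 2 * (A * H / N - g) * (x * y) + (1 + H ^ 2 / N) * y ^ 2)
        + (x * A + y * H + z * N) ^ 2 / N := by
      rw [show B v a = -A by rw [hA]; ring, show B v b = - H by rw [hH]; ring,
        show B v v = - N by rw [hNd]; ring, show B a b = - g by rw [hg]; ring]
      field_simp
      ring
    rw [key]
    by_cases h0 : x = 0 ∧ y = 0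
    · obtain ⟨rfl, rfl⟩ := h0
      have hz : z ≠ 0 := by rintro rfl; simp at hu
      simp; positivity
    · have := quad_pos (by positivity) gram h0
      have : 0 ≤ (x * A + y * H + z * N) ^ 2 / N := by positivity
      linarith
  · left
    -- B v v = 0
    have hmc : m * B v c ≤ l * 0 := by nlinarith
    have c1 : l * B v a = 0 := by
      have h1 : l * B v a ≤ 0 := by nlinarith
      have h2 : m * B v c ≤ 0 := by nlinarith
      linarith
    have c2 : n * B v b = 0 := by
      have h1 : n * B v b ≤ 0 := by nlinarith
      have h2 : o * B v d ≤ 0 := by nlinarith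
      linarith
    have c3 : B v a = 0 := (mul_eq_zero.1 c1).resolve_left hl.ne'
    have c4 : B v b = 0 := (mul_eq_zero.1 c2).resolve_left hn.ne'
    have c5 : B a b = 0 := by
      have h1 : n * B a b ≤ 0 := by nlinarith
      have h2 : o * B a d ≤ 0 := by nlinarith
      have h3 : n * B a b = 0 := by linarith
      exact (mul_eq_zero.1 h3).resolve_left hn.ne'
    have hθv : 0 < θ v := by
      rw [hv]; simp only [map_add, map_smul, smul_eq_mul]
      have := hθ a Q.ha.1
      have := hθ c Q.hc.1
      positivity
    intro u hu
    obtain ⟨x, y, z, rfl⟩ := Q.spanv u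
    rw [← hv] at hu ⊢
    rw [hBu, c3, c4, c5, hN]
    by_cases h0 : x = 0 ∧ y = 0
    · obtain ⟨rfl, rfl⟩ := h0
      have hz : z ≠ 0 := by rintro rfl; simp at hu
      have hz2 : 0 < (z * θ v) ^ 2 := by positivity
      simpa using hz2
    · have := quad_pos (P := 1) (Q := 1) (R := 0) one_pos (by norm_num) h0
      have := sq_nonneg (θ (x • a + y • b + z • v))
      linarith

end algebra

section top
variable {E : Type*} [NormedAddCommGroup E] [NormedSpace ℝ E] [FiniteDimensional ℝ E]
variable {B : E →ₗ[ℝ] E →ₗ[ℝ] ℝ} {C S : Set E} {a b c d : E} {l m n o : ℝ}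

theorem cont_B (B : E →ₗ[ℝ] E →ₗ[ℝ] ℝ) : Continuous fun p : E × E => B p.1 p.2 := by
  have : Continuous fun p : E × E => B.toContinuousBilinearMap p.1 p.2 := by fun_prop
  exact this

theorem cont_L (θ : E →ₗ[ℝ] ℝ) : Continuous θ := θ.continuous_of_finiteDimensional

theorem coercive {K : ℝ} {f : E →ₗ[ℝ] ℝ} (hpos : ∀ u, u ≠ 0 → 0 < B u u + K * f u ^ 2) :
    ∃ k : ℝ, 0 < k ∧ ∀ u, k * ‖u‖ ^ 2 ≤ B u u + K * f u ^ 2 := by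
  have hc : Continuous fun u : E => B u u + K * f u ^ 2 := by
    have h1 := (cont_B B).comp (continuous_id.prodMk continuous_id)
    have h2 := cont_L f
    exact h1.add (continuous_const.mul (h2.pow 2))
  have hcomp : IsCompact (Metric.sphere (0 : E) 1) := isCompact_sphere 0 1
  rcases (Metric.sphere (0 : E) 1).eq_empty_or_nonempty with he | hne
  · refine ⟨1, one_pos, fun u => ?_⟩
    have hu : u = 0 := by
      by_contra hu
      have : (‖u‖⁻¹) • u ∈ Metric.sphere (0 : E) 1 := by
        simp [norm_smul, norm_ne_zero_iff.2 hu]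
      rw [he] at this; exact this
    simp [hu]
  · obtain ⟨x, hx, hmin⟩ := hcomp.exists_isMinOn hne hc.continuousOn
    have hx0 : x ≠ 0 := by rintro rfl; simp at hx
    refine ⟨_, hpos x hx0, fun u => ?_⟩
    by_cases hu : u = 0
    · simp [hu]
    · have hn : ‖u‖ ≠ 0 := norm_ne_zero_iff.2 hu
      have h1 := hmin (show (‖u‖⁻¹) • u ∈ Metric.sphere (0 : E) 1 by simp [norm_smul, hn])
      simp only [mem_ofPred_eq, map_smul, LinearMap.smul_apply, smul_eq_mul] at h1
      calc _ ≤ (‖u‖⁻¹ * (‖u‖⁻¹ * B u u) + K * (‖u‖⁻¹ * f u) ^ 2) * ‖u‖ ^ 2 := by gcongr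
        _ = _ := by field_simp

theorem bounded_L (θ : E →ₗ[ℝ] ℝ) : ∃ M : ℝ, 0 < M ∧ ∀ u, θ u ^ 2 ≤ M * ‖u‖ ^ 2 := by
  refine ⟨‖θ.toContinuousLinearMap‖ ^ 2 + 1, by positivity, fun u => ?_⟩
  have h1 : |θ u| ≤ ‖θ.toContinuousLinearMap‖ * ‖u‖ := by
    have := θ.toContinuousLinearMap.le_opNorm u
    simpa using this
  have h2 : θ u ^ 2 ≤ (‖θ.toContinuousLinearMap‖ * ‖u‖) ^ 2 := by
    rw [← sq_abs (θ u)]; exact pow_le_pow_left₀ (abs_nonneg _) h1 2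
  nlinarith [sq_nonneg ‖u‖]

theorem Quad.exists_theta (h : Sys B C S) (Q : Quad B S a b c d l m n o) :
    ∃ θ : E →ₗ[ℝ] ℝ, (∀ x ∈ S, 0 < θ x) ∧ ∀ u, u ≠ 0 → 0 < B u u + θ u ^ 2 := by
  obtain ⟨θ, hθ⟩ := Q.exists_pos h
  rcases Q.posdef h hθ with h1 | ⟨K, hK, hp⟩
  · exact ⟨θ, hθ, h1⟩
  obtain ⟨k, hk, hc⟩ := coercive hp
  obtain ⟨M, hM, hb⟩ := bounded_L θ
  set f := B (l • a + m • c) with hf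
  -- choose ε
  set ε := Real.sqrt (k / (4 * K * M)) with hε
  have hε0 : 0 < ε := by rw [hε]; positivity
  have hε2 : ε ^ 2 = k / (4 * K * M) := by rw [hε, Real.sq_sqrt]; positivity
  refine ⟨Real.sqrt (2 * K) • (ε • θ - f), fun x hx => ?_, fun u hu => ?_⟩
  · simp only [LinearMap.smul_apply, LinearMap.sub_apply, smul_eq_mul]
    have h1 := Q.f_nonneg h hθ hx
    have h2 := hθ x hx
    have : 0 < Real.sqrt (2 * K) := by positivity
    have : 0 < ε * θ x - f x := by
      have : 0 < ε * θ x := by positivity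
      linarith
    positivity
  · simp only [LinearMap.smul_apply, LinearMap.sub_apply, smul_eq_mul, mul_pow]
    rw [Real.sq_sqrt (by positivity)]
    have h1 := hc u
    have h2 := hb u
    have h3 : 0 < ‖u‖ ^ 2 := by have := norm_pos_iff.2 hu; positivity
    have h4 : f u ^ 2 / 2 - (ε * θ u) ^ 2 ≤ (ε * θ u - f u) ^ 2 := by
      nlinarith [sq_nonneg (2 * (ε * θ u) - f u)]
    have h5 : 2 * K * (ε * θ u) ^ 2 ≤ k / 2 * ‖u‖ ^ 2 := by
      rw [mul_pow, hε2]
      calc 2 * K * (k / (4 * K * M) * θ u ^ 2) ≤ 2 * K * (k / (4 * K * M) * (M * ‖u‖ ^ 2)) := by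
            gcongr
        _ = k / 2 * ‖u‖ ^ 2 := by field_simp; norm_num
    have h6 : 2 * K * (f u ^ 2 / 2 - (ε * θ u) ^ 2) ≤ 2 * K * (ε * θ u - f u) ^ 2 := by gcongr
    have h7 : 0 < k / 2 * ‖u‖ ^ 2 := by positivity
    nlinarith

/-- sublevel sets are finite -/
theorem Quad.finite_sublevel (h : Sys B C S) (Q : Quad B S a b c d l m n o) {θ : E →ₗ[ℝ] ℝ}
    (hθ : ∀ x ∈ S, 0 < θ x) (hq : ∀ u, u ≠ 0 → 0 < B u u + θ u ^ 2) (M : ℝ) :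
    {x | x ∈ S ∧ θ x ≤ M}.Finite := by
  by_contra hinf
  obtain ⟨k, hk, hc⟩ := coercive (K := 1) (f := θ) (B := B) (by simpa using hq)
  have hinf' : {x | x ∈ S ∧ θ x ≤ M}.Infinite := hinf
  set X := {x | x ∈ S ∧ θ x ≤ M} with hX
  have hbd : X ⊆ Metric.closedBall (0 : E) (Real.sqrt ((1 + M ^ 2) / k)) := by
    rintro x ⟨hx, hxM⟩
    rw [mem_closedBall_zero_iff]
    apply Real.le_sqrt_of_sq_le
    rw [le_div_iff₀ hk]
    have h1 := hc x
    rw [h.unit x hx] at h1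
    have := hθ x hx
    nlinarith
  obtain ⟨z, hz, hacc⟩ := hinf'.exists_accPt_of_subset_isCompact (isCompact_closedBall _ _) hbd
  -- a simple root not orthogonal to z
  have hBc : Continuous fun x : E => B x x := (cont_B B).comp (continuous_id.prodMk continuous_id)
  have hcl : z ∈ closure X := mem_closure_iff_clusterPt.2 hacc.clusterPt
  have hzz : B z z = 1 := by
    have : closure X ⊆ {x | B x x = 1} :=
      closure_minimal (fun x hx => h.unit x hx.1) (isClosed_eq hBc continuous_const)
    exact this hcl
  have hex : ∃ x ∈ Simp B S ⊤, B z x ≠ 0 := by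
    by_contra hcon
    push Not at hcon
    obtain ⟨p, q, r, e⟩ := Q.span3 z
    have : B z z = 0 := by
      nth_rw 2 [e]
      simp [hcon a Q.ha, hcon b Q.hb, hcon c Q.hc]
    linarith
  obtain ⟨x, hx, hzx⟩ := hex
  -- the function (s,t) ↦ s_s s_t x
  let F : E × E → E := fun p => rf B p.1 (rf B p.2 x)
  have hF : Continuous F := by
    have c1 : Continuous fun p : E × E => rf B p.2 x := by
      simp only [rf]
      have := (cont_B B).comp (continuous_snd.prodMk (continuous_const (y := x)) : 
        Continuous fun p : E × E => (p.2, x))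
      exact continuous_const.sub ((continuous_const.mul this).smul continuous_snd)
    have := (cont_B B).comp (continuous_fst.prodMk c1)
    exact c1.sub ((continuous_const.mul this).smul continuous_fst)
  have hθc := cont_L θ
  have hxx := h.unit x hx.1
  have hFz : F (z, z) = x := rf_rf hzz x
  have hrc : Continuous fun y : E => θ (rf B x y) := by
    simp only [rf]
    have := (cont_B B).comp ((continuous_const (y := x)).prodMk continuous_id : 
        Continuous fun y : E => (x, y))
    exact hθc.comp (continuous_id.sub ((continuous_const.mul this).smul continuous_const))
  have ev1 : ∀ᶠ p in nhds ((z, z) : E × E), 0 < θ (F p) := by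
    apply ((hθc.comp hF).continuousAt (x := (z, z))).eventually_const_lt
    simp only [Function.comp, hFz]; exact hθ x hx.1
  have ev2 : ∀ᶠ p in nhds ((z, z) : E × E), θ (rf B x (F p)) < 0 := by
    apply ((hrc.comp hF).continuousAt (x := (z, z))).eventually_lt_const
    simp only [Function.comp, hFz, rf_self hxx, map_neg]
    linarith [hθ x hx.1]
  have ev3 : ∀ᶠ s in nhds z, B s x ≠ 0 := by
    have := (cont_B B).comp (continuous_id.prodMk (continuous_const (y := x)) : 
        Continuous fun y : E => (y, x))
    exact (this.continuousAt (x := z)).eventually_ne hzx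
  rw [nhds_prod_eq] at ev1 ev2
  obtain ⟨U, hU, V, hV, hUV⟩ := Filter.mem_prod_iff.1 (ev1.and ev2)
  have hW : U ∩ V ∩ {s | B s x ≠ 0} ∈ nhds z := Filter.inter_mem (Filter.inter_mem hU hV) ev3
  -- two distinct points
  have hinfW : ((U ∩ V ∩ {s | B s x ≠ 0}) ∩ X).Infinite := by
    intro hfin
    rw [accPt_iff_frequently] at hacc
    set Y := (U ∩ V ∩ {s | B s x ≠ 0}) ∩ X
    have hY : (Y \ {z}).Finite := hfin.subset sdiff_subset
    have : (Y \ {z})ᶜ ∈ nhds z := hY.isClosed.isOpen_compl.mem_nhds (by simp)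
    obtain ⟨y, ⟨hyz, hyX⟩, hy1, hy2⟩ := (hacc.and_eventually (Filter.inter_mem hW this)).exists
    exact hy2 ⟨⟨hy1, hyX⟩, hyz⟩
  obtain ⟨s, hs⟩ := hinfW.nonempty
  obtain ⟨t, ht, hst⟩ := hinfW.exists_notMem_finite (finite_singleton s)
  have hts : t ≠ s := by simpa using hst
  obtain ⟨⟨⟨hsU, hsV⟩, hsx⟩, hsS, -⟩ := hs
  obtain ⟨⟨⟨htU, htV⟩, htx⟩, htS, -⟩ := ht
  have hmem := hUV (show (s, t) ∈ U ×ˢ V from ⟨hsU, htV⟩)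
  obtain ⟨hm1, hm2⟩ := hmem
  have key : ∀ ξ : E, (ξ ∈ S ∨ -ξ ∈ S) → 0 < θ ξ → ξ ∈ S := by
    rintro ξ (h1 | h1) h2
    · exact h1
    · have := hθ _ h1; rw [map_neg] at this; linarith
  have hFS : F (s, t) ∈ S ∨ -F (s, t) ∈ S := by
    simp only [F]
    rcases h.refl t htS x hx.1 with h1 | h1
    · exact h.refl s hsS _ h1
    · have := h.refl s hsS _ h1
      rw [rf_neg, neg_neg] at this
      exact this.symm
  have hFS' := key _ hFS hm1
  have hne : F (s, t) ≠ x := by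
    intro he
    simp only [F] at he
    have h1 : rf B t x = rf B s x := by
      rw [← he, rf_rf (h.unit s hsS), he]
    have h2 : (B t x) • t = (B s x) • s := by
      have h3 : (2 * B t x) • t = (2 * B s x) • s := sub_right_injective h1
      rw [mul_smul, mul_smul] at h3
      exact smul_right_injective E (two_ne_zero (α := ℝ)) h3
    -- unit vectors, proportional
    have h4 : t = (B s x / B t x) • s := by
      rw [div_eq_inv_mul, mul_smul, ← h2, smul_smul, inv_mul_cancel₀ htx, one_smul]
    set r := B s x / B t x
    have h5 := h.unit t htS
    rw [h4] at h5
    simp only [map_smul, LinearMap.smul_apply, smul_eq_mul, h.unit s hsS] at h5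
    have h6 : 0 < r := by
      have := hθ t htS
      rw [h4, map_smul, smul_eq_mul] at this
      exact pos_of_mul_pos_left this (hθ s hsS).le
    have h7 : r = 1 := by nlinarith
    exact hts (by rw [h4, h7, one_smul])
  have := hθ _ (hx.2.2 _ hFS' trivial hne)
  linarith

end top
end RootCore

namespace RootCore

variable {E : Type*} [AddCommGroup E] [Module ℝ E]
variable {B : E →ₗ[ℝ] E →ₗ[ℝ] ℝ} {C S : Set E} {θ : E →ₗ[ℝ] ℝ} {T : Submodule ℝ E}

/-- A system with a good height function. -/
structure Good (B : E →ₗ[ℝ] E →ₗ[ℝ] ℝ) (C S : Set E) (θ : E →ₗ[ℝ] ℝ) : Prop where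
  sys : Sys B C S
  pos : ∀ x ∈ S, 0 < θ x
  pd : ∀ u, u ≠ 0 → 0 < B u u + θ u ^ 2
  fin : ∀ M : ℝ, {x | x ∈ S ∧ θ x ≤ M}.Finite

namespace Good

theorem prop_eq (g : Good B C S θ) {x y : E} (hx : x ∈ S) (hy : y ∈ S) {r : ℝ}
    (e : x = r • y) : x = y := by
  have h5 := g.sys.unit x hx
  rw [e] at h5
  simp only [map_smul, LinearMap.smul_apply, smul_eq_mul, g.sys.unit y hy] at h5
  have h6 : 0 < r := by
    have := g.pos x hx
    rw [e, map_smul, smul_eq_mul] at this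
    exact pos_of_mul_pos_left this (g.pos y hy).le
  have h7 : r = 1 := by nlinarith
  rw [e, h7, one_smul]

theorem not_neg_mem (g : Good B C S θ) {x : E} (hx : x ∈ S) (hn : -x ∈ S) : False := by
  have := g.pos x hx
  have := g.pos _ hn
  rw [map_neg] at this
  linarith

theorem ineq (g : Good B C S θ) {x y : E} (hx : x ∈ S) (hy : y ∈ S) (hxy : x ≠ y)
    (hle : θ y ≤ θ x) : B x y * θ y < θ x := by
  by_contra hcon
  push Not at hcon
  set t := θ x with ht
  set t' := θ y with ht'
  set β := B x y with hβ
  have ht0 : 0 < t := g.pos x hx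
  have ht0' : 0 < t' := g.pos y hy
  set r := β + t * t' with hr
  set u := (1 + t' ^ 2) • x - r • y with hu
  have e1 : B u u + θ u ^ 2 = (1 + t' ^ 2) * ((1 + t ^ 2) * (1 + t' ^ 2) - r ^ 2) := by
    rw [hu]
    simp only [map_sub, map_smul, LinearMap.sub_apply, LinearMap.smul_apply, smul_eq_mul,
      g.sys.unit x hx, g.sys.unit y hy, g.sys.symm y x, ← hβ, ← ht, ← ht']
    rw [hr]; ring
  have e2 : (1 + t ^ 2) * (1 + t' ^ 2) ≤ r ^ 2 := by
    have h1 : t * (1 + t' ^ 2) ≤ r * t' := by rw [hr]; nlinarith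
    have h2 : (t * (1 + t' ^ 2)) ^ 2 ≤ (r * t') ^ 2 :=
      pow_le_pow_left₀ (by positivity) h1 2
    have h3 : t' ^ 2 * ((1 + t ^ 2) * (1 + t' ^ 2)) ≤ (t * (1 + t' ^ 2)) ^ 2 := by
      have : t' ^ 2 ≤ t ^ 2 := pow_le_pow_left₀ ht0'.le hle 2
      have h4 : t' ^ 2 * (1 + t ^ 2) ≤ t ^ 2 * (1 + t' ^ 2) := by nlinarith
      have h5 := mul_le_mul_of_nonneg_right h4 (show 0 ≤ 1 + t' ^ 2 by positivity)
      nlinarith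
    have h6 : t' ^ 2 * ((1 + t ^ 2) * (1 + t' ^ 2)) ≤ t' ^ 2 * r ^ 2 := by
      calc _ ≤ _ := h3
        _ ≤ _ := h2
        _ = _ := by ring
    exact le_of_mul_le_mul_left h6 (by positivity)
  have hu0 : u = 0 := by
    by_contra hu0
    have := g.pd u hu0
    rw [e1] at this
    have h7 : 0 < 1 + t' ^ 2 := by positivity
    nlinarith
  apply hxy
  have h8 : 1 + t' ^ 2 ≠ 0 := by positivity
  apply g.prop_eq hx hy (r := r / (1 + t' ^ 2))
  rw [hu, sub_eq_zero] at hu0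
  rw [div_eq_inv_mul, mul_smul, ← hu0, smul_smul, inv_mul_cancel₀ h8, one_smul]

theorem dec (g : Good B C S θ) {z : E} (hz : z ∈ S) (hzT : z ∈ T) (hns : z ∉ Simp B S T) :
    ∃ y ∈ S, y ∈ T ∧ θ y < θ z ∧ 0 < B z y := by
  have : ∃ y ∈ S, y ∈ T ∧ y ≠ z ∧ rf B z y ∉ S := by
    by_contra hcon
    push Not at hcon
    exact hns ⟨hz, hzT, hcon⟩
  obtain ⟨y, hy, hyT, hyz, hr⟩ := this
  have hy' : -(rf B z y) ∈ S := (g.sys.refl z hz y hy).resolve_left hr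
  set y' := -(rf B z y) with hyd
  have ey : y' = (2 * B z y) • z - y := by rw [hyd, rf]; abel
  have hyT' : y' ∈ T := T.neg_mem (rf_mem_T hzT hyT)
  have p1 := g.pos z hz
  have p2 := g.pos y hy
  have p3 := g.pos y' hy'
  have e3 : θ y' = 2 * B z y * θ z - θ y := by rw [ey]; simp
  have hk : 0 < B z y := by
    by_contra hk
    push Not at hk
    nlinarith
  have hk' : 0 < B z y' := by
    rw [ey]; simp [g.sys.unit z hz]; linarith
  have hyz' : y' ≠ z := by
    intro he
    apply hyz
    apply g.prop_eq hy hz (r := 2 * B z y - 1)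
    rw [sub_smul, one_smul]; nth_rw 3 [← he]; rw [ey]; abel
  by_cases h1 : θ y < θ z
  · exact ⟨y, hy, hyT, h1, hk⟩
  · by_cases h2 : θ y' < θ z
    · exact ⟨y', hy', hyT', h2, hk'⟩
    · exfalso
      push Not at h1 h2
      have i1 := g.ineq hy hz hyz h1
      have i2 := g.ineq hy' hz hyz' h2
      rw [g.sys.symm y z] at i1
      have : B y' z = B z y := by
        rw [g.sys.symm, ey]; simp [g.sys.unit z hz]; ring
      rw [this] at i2
      linarith

theorem induct (g : Good B C S θ) (T : Submodule ℝ E) {P : E → Prop}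
    (hs : ∀ x ∈ Simp B S T, P x)
    (hstep : ∀ y x, y ∈ S → y ∈ T → P y → x ∈ S → x ∈ T → P x → ∀ z ∈ S,
      (z = rf B y x ∨ z = - rf B y x) → P z) :
    ∀ z ∈ S, z ∈ T → P z := by
  by_contra hcon
  push Not at hcon
  obtain ⟨z0, hz0, hzT0, hP0⟩ := hcon
  have hfin : {x | (x ∈ S ∧ θ x ≤ θ z0) ∧ x ∈ T ∧ ¬ P x}.Finite :=
    (g.fin (θ z0)).subset fun x hx => hx.1
  obtain ⟨z, ⟨⟨hz, hzle⟩, hzT, hPz⟩, hmin⟩ := Set.exists_min_image _ θ hfin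
    ⟨z0, ⟨⟨hz0, le_rfl⟩, hzT0, hP0⟩⟩
  have hlt : ∀ x ∈ S, x ∈ T → θ x < θ z → P x := by
    intro x hx hxT hlt
    by_contra hPx
    have := hmin x ⟨⟨hx, by linarith⟩, hxT, hPx⟩
    linarith
  obtain ⟨y, hy, hyT, hyz, hk⟩ := g.dec hz hzT fun h => hPz (hs z h)
  have hPy := hlt y hy hyT hyz
  have hne : z ≠ y := by rintro rfl; linarith
  have i1 := g.ineq hz hy hne hyz.le
  have py := g.pos y hy
  have hw : θ (rf B y z) = θ z - 2 * B z y * θ y := by simp [rf, g.sys.symm y z]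
  have hpp : 0 < B z y * θ y := mul_pos hk py
  have hmT : rf B y z ∈ T := rf_mem_T hyT hzT
  have hyy := g.sys.unit y hy
  rcases g.sys.refl y hy z hz with h1 | h1
  · have hP := hlt _ h1 hmT (by rw [hw]; linarith)
    exact hPz (hstep y _ hy hyT hPy h1 hmT hP z hz (Or.inl (rf_rf hyy z).symm))
  · have hP := hlt _ h1 (T.neg_mem hmT) (by rw [map_neg, hw]; linarith)
    exact hPz (hstep y _ hy hyT hPy h1 (T.neg_mem hmT) hP z hz
      (Or.inr (by rw [rf_neg, neg_neg, rf_rf hyy])))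

theorem rel2 (g : Good B C S θ) {x y : E} (hx : x ∈ S) (hy : y ∈ S) (hxy : x ≠ y) {p q : ℝ}
    (e : p • x + q • y = 0) : p = 0 ∧ q = 0 := by
  have hp : p = 0 := by
    by_contra hp
    apply hxy
    apply g.prop_eq hx hy (r := - (p⁻¹ * q))
    have : p⁻¹ • (p • x + q • y) = 0 := by rw [e, smul_zero]
    rw [smul_add, smul_smul, smul_smul, inv_mul_cancel₀ hp, one_smul] at this
    rw [neg_smul]; exact eq_neg_of_add_eq_zero_left this
  refine ⟨hp, ?_⟩
  rw [hp, zero_smul, zero_add] at e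
  exact (smul_eq_zero.1 e).resolve_right (g.sys.ne_zero hy)

theorem coeff_nonneg_aux (g : Good B C S θ) {x y : E} (hx : x ∈ Simp B S ⊤)
    (hy : y ∈ Simp B S ⊤) (hxy : x ≠ y) {p q : ℝ} (hz : p • x + q • y ∈ S) : 0 ≤ q := by
  by_contra hq
  push Not at hq
  have px := g.pos x hx.1
  have py := g.pos y hy.1
  have pz := g.pos _ hz
  simp only [map_add, map_smul, smul_eq_mul] at pz
  have hp : 0 < p := by
    by_contra hp
    push Not at hp
    nlinarith
  have hne : p • x + q • y ≠ x := by
    intro he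
    have := (g.rel2 hx.1 hy.1 hxy (p := p - 1) (q := q) (by
      rw [sub_smul, one_smul]; nth_rw 2 [← he]; abel)).2
    linarith
  have h1 := g.pos _ (hx.2.2 _ hz trivial hne)
  have hxx := g.sys.unit x hx.1
  have ho := g.sys.obtuse hx hy hxy
  simp only [rf, map_add, map_sub, map_smul, smul_eq_mul, hxx] at h1
  have h2 : 0 ≤ q * B x y := mul_nonneg_of_nonpos_of_nonpos hq.le ho
  have h3 : 0 ≤ (q * B x y) * θ x := by positivity
  nlinarith

theorem coeff_nonneg (g : Good B C S θ) {x y : E} (hx : x ∈ Simp B S ⊤)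
    (hy : y ∈ Simp B S ⊤) (hxy : x ≠ y) {p q : ℝ} (hz : p • x + q • y ∈ S) : 0 ≤ p ∧ 0 ≤ q :=
  ⟨g.coeff_nonneg_aux hy hx hxy.symm (by rwa [add_comm]), g.coeff_nonneg_aux hx hy hxy hz⟩

/-- a rank two subspace has at most two simple roots -/
theorem simp_two (g : Good B C S θ) (δ ε : E) :
    ∃ x y, Simp B S (Submodule.span ℝ {δ, ε}) ⊆ {x, y} := by
  set T := Submodule.span ℝ {δ, ε} with hT
  by_contra hcon
  push Not at hcon
  obtain ⟨x, hx, -⟩ := not_subset.1 (hcon 0 0)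
  obtain ⟨y, hy, hyx⟩ := not_subset.1 (hcon x x)
  obtain ⟨z, hz, hzx⟩ := not_subset.1 (hcon x y)
  simp only [mem_insert_iff, mem_singleton_iff, not_or, or_self] at hyx hzx
  have hxT : x ∈ T := hx.2.1
  have hyT : y ∈ T := hy.2.1
  have hzT : z ∈ T := hz.2.1
  have hli : LinearIndependent ℝ ![(⟨x, hxT⟩ : T), ⟨y, hyT⟩, ⟨z, hzT⟩] := by
    rw [Fintype.linearIndependent_iff]
    intro f hf i
    simp only [Fin.sum_univ_three, Matrix.cons_val_zero, Matrix.cons_val_one,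
      Matrix.cons_val] at hf
    have hf' := congrArg (Subtype.val) hf
    simp only [Submodule.coe_add, Submodule.coe_smul, Submodule.coe_zero] at hf'
    obtain ⟨h1, h2, h3⟩ := g.sys.rel3 hx.1 hy.1 hz.1 (g.sys.obtuse hx hy (Ne.symm hyx))
      (g.sys.obtuse hx hz (Ne.symm hzx.1)) (g.sys.obtuse hy hz (Ne.symm hzx.2)) hf'
    fin_cases i <;> assumption
  have : FiniteDimensional ℝ T := FiniteDimensional.span_of_finite ℝ (by simp)
  have h1 := hli.fintype_card_le_finrank
  have h2 : Module.finrank ℝ T ≤ 2 := by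
    classical
    have := finrank_span_finset_le_card (R := ℝ) ({δ, ε} : Finset E)
    have h3 : ({δ, ε} : Finset E).card ≤ 2 := Finset.card_le_two
    simp only [Finset.coe_insert, Finset.coe_singleton] at this
    exact this.trans h3
  simp at h1
  omega

end Good
end RootCore

namespace RootCore

variable {E : Type*} [AddCommGroup E] [Module ℝ E]

/-- the free real vector space on the simple roots -/
abbrev FM (B : E →ₗ[ℝ] E →ₗ[ℝ] ℝ) (S : Set E) := (Simp B S ⊤) →₀ ℝ

noncomputable section

/-- projection to `E` -/
def pr (B : E →ₗ[ℝ] E →ₗ[ℝ] ℝ) (S : Set E) : FM B S →ₗ[ℝ] E :=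
  Finsupp.linearCombination ℝ (Subtype.val : (Simp B S ⊤) → E)

/-- basis vector -/
def ev {B : E →ₗ[ℝ] E →ₗ[ℝ] ℝ} {S : Set E} (x : Simp B S ⊤) : FM B S := Finsupp.single x 1

/-- lifted simple reflection -/
def sr {B : E →ₗ[ℝ] E →ₗ[ℝ] ℝ} {S : Set E} (x : Simp B S ⊤) : Module.End ℝ (FM B S) :=
  LinearMap.id - (((2 : ℝ) • (B x.1)) ∘ₗ (pr B S)).smulRight (ev x)

/-- action of words -/
def act {B : E →ₗ[ℝ] E →ₗ[ℝ] ℝ} {S : Set E} (l : List (Simp B S ⊤)) : Module.End ℝ (FM B S) :=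
  (l.map sr).prod

end

variable {B : E →ₗ[ℝ] E →ₗ[ℝ] ℝ} {C S : Set E} {θ : E →ₗ[ℝ] ℝ}

@[simp] theorem pr_ev (x : Simp B S ⊤) : pr B S (ev x) = x.1 := by
  simp [pr, ev]

theorem sr_apply (x : Simp B S ⊤) (u : FM B S) : sr x u = u - (2 * B x.1 (pr B S u)) • ev x := by
  simp [sr]

theorem pr_sr (x : Simp B S ⊤) (u : FM B S) : pr B S (sr x u) = rf B x.1 (pr B S u) := by
  rw [sr_apply, map_sub, map_smul, pr_ev, rf]

theorem act_nil : act ([] : List (Simp B S ⊤)) = 1 := rfl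

theorem act_cons (x : Simp B S ⊤) (l : List (Simp B S ⊤)) : act (x :: l) = sr x * act l := by
  simp [act]

theorem act_append (l l' : List (Simp B S ⊤)) : act (l ++ l') = act l * act l' := by
  simp [act]

theorem act_single (x : Simp B S ⊤) : act [x] = sr x := by simp [act]

namespace Good

theorem sr_sr (g : Good B C S θ) (x : Simp B S ⊤) : sr x * sr x = 1 := by
  ext1 u
  apply LinearMap.ext
  intro t
  change sr x (sr x _) = _
  simp only [sr_apply, map_sub, map_smul, pr_ev, g.sys.unit x.1 x.2.1]
  simp only [Module.End.one_eq_id, LinearMap.id_comp]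
  module

theorem sr_ev (g : Good B C S θ) (x : Simp B S ⊤) : sr x (ev x) = - ev x := by
  rw [sr_apply, pr_ev, g.sys.unit x.1 x.2.1]; module

theorem act_reverse (g : Good B C S θ) (l : List (Simp B S ⊤)) : act l.reverse * act l = 1 := by
  induction l with
  | nil => simp [act_nil]
  | cons x l ih =>
    rw [List.reverse_cons, act_append, act_single, act_cons, mul_assoc, ← mul_assoc (sr x),
      g.sr_sr, one_mul, ih]

theorem act_reverse' (g : Good B C S θ) (l : List (Simp B S ⊤)) : act l * act l.reverse = 1 := by
  simpa using g.act_reverse l.reverse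

theorem B_act (g : Good B C S θ) (l : List (Simp B S ⊤)) (u v : FM B S) :
    B (pr B S (act l u)) (pr B S (act l v)) = B (pr B S u) (pr B S v) := by
  induction l with
  | nil => simp [act_nil]
  | cons x l ih =>
    rw [act_cons, Module.End.mul_apply, Module.End.mul_apply, pr_sr, pr_sr,
      B_rf_rf g.sys.symm (g.sys.unit _ x.2.1), ih]

theorem act_root (g : Good B C S θ) (l : List (Simp B S ⊤)) (x : Simp B S ⊤) :
    pr B S (act l (ev x)) ∈ S ∨ - pr B S (act l (ev x)) ∈ S := by
  induction l with
  | nil => left; simpa [act_nil] using x.2.1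
  | cons y l ih =>
    rw [act_cons, Module.End.mul_apply, pr_sr]
    rcases ih with h | h
    · exact g.sys.refl _ y.2.1 _ h
    · have := g.sys.refl _ y.2.1 _ h
      rw [rf_neg, neg_neg] at this
      exact this.symm

/-- conjugation of a reflection -/
theorem conj (g : Good B C S θ) (l : List (Simp B S ⊤)) (x z : Simp B S ⊤)
    (h : act l (ev x) = ev z) : act l * sr x = sr z * act l := by
  apply LinearMap.ext
  intro u
  rw [Module.End.mul_apply, Module.End.mul_apply, sr_apply, sr_apply, map_sub, map_smul, h]
  congr 3
  have := g.B_act l (ev x) u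
  rw [h, pr_ev, pr_ev] at this
  rw [this]

/-- the dihedral step -/
theorem dihedral (g : Good B C S θ) {x y : Simp B S ⊤} (hxy : x ≠ y)
    (u : List (Simp B S ⊤)) (hu : ∀ z ∈ u, z = x ∨ z = y) :
    (∃ p q : ℝ, 0 ≤ p ∧ 0 ≤ q ∧ act u (ev x) = p • ev x + q • ev y) ∨
    ∃ u', u'.length < u.length ∧ act u * sr x = act u' := by
  have hxy' : x.1 ≠ y.1 := fun h => hxy (Subtype.ext h)
  induction u with
  | nil => exact Or.inl ⟨1, 0, zero_le_one, le_rfl, by simp [act_nil]⟩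
  | cons z u ih =>
    have hz := hu z (by simp)
    rcases ih fun z hz => hu z (by simp [hz]) with ⟨p, q, hp, hq, e⟩ | ⟨u', hlen, e⟩
    · -- the root
      have hpr : pr B S (act u (ev x)) = p • x.1 + q • y.1 := by rw [e]; simp
      have hS : p • x.1 + q • y.1 ∈ S := by
        rcases g.act_root u x with h | h
        · rwa [hpr] at h
        · exfalso
          have := g.pos _ h
          rw [hpr] at this
          simp only [map_neg, map_add, map_smul, smul_eq_mul] at this
          have := g.pos _ x.2.1
          have := g.pos _ y.2.1
          nlinarith
      by_cases hzr : p • x.1 + q • y.1 = z.1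
      · right
        have hez : act u (ev x) = ev z := by
          rw [e]
          rcases hz with hz | hz <;> rw [hz] at hzr ⊢
          · have := g.rel2 x.2.1 y.2.1 hxy' (p := p - 1) (q := q) (by
              rw [sub_smul, one_smul, ← sub_eq_zero.2 hzr]; abel)
            rw [this.2, show p = 1 by linarith [this.1]]; simp
          · have := g.rel2 x.2.1 y.2.1 hxy' (p := p) (q := q - 1) (by
              rw [sub_smul, one_smul, ← sub_eq_zero.2 hzr]; abel)
            rw [this.1, show q = 1 by linarith [this.2]]; simp
        refine ⟨u, by simp, ?_⟩
        rw [act_cons, mul_assoc, g.conj u x z hez, ← mul_assoc, g.sr_sr, one_mul]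
      · left
        have h1 := z.2.2.2 _ hS trivial hzr
        have : ∃ p' q' : ℝ, act (z :: u) (ev x) = p' • ev x + q' • ev y := by
          rw [act_cons, Module.End.mul_apply, e, sr_apply]
          rcases hz with hz | hz <;> rw [hz]
          · exact ⟨_, _, by rw [add_sub_right_comm, ← sub_smul]⟩
          · exact ⟨_, _, by rw [add_sub_assoc, ← sub_smul]⟩
        obtain ⟨p', q', e'⟩ := this
        have h2 : pr B S (act (z :: u) (ev x)) = p' • x.1 + q' • y.1 := by rw [e']; simp
        rw [act_cons, Module.End.mul_apply, pr_sr, hpr] at h2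
        rw [h2] at h1
        obtain ⟨h3, h4⟩ := g.coeff_nonneg x.2 y.2 hxy' h1
        exact ⟨p', q', h3, h4, e'⟩
    · right
      refine ⟨z :: u', by simpa using hlen, ?_⟩
      rw [act_cons, act_cons, mul_assoc, e]

theorem humphreys (g : Good B C S θ) : ∀ (n : ℕ) (l : List (Simp B S ⊤)) (x : Simp B S ⊤),
    l.length = n → (∀ l', act l' = act l → n ≤ l'.length) →
    (∀ l', act l' = act l * sr x → n ≤ l'.length) → 0 ≤ act l (ev x) := by
  intro n
  induction n using Nat.strong_induction_on with
  | _ n IH =>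
    intro l x hn hred hx
    have hev : ∀ y : Simp B S ⊤, 0 ≤ ev y := fun y => by
      unfold ev; exact Finsupp.single_nonneg.2 zero_le_one
    rcases List.eq_nil_or_concat l with rfl | ⟨l', y, rfl⟩
    · rw [act_nil]; exact hev x
    simp only [List.concat_eq_append] at hn hred hx ⊢
    have hlen : l'.length + 1 = n := by simpa using hn
    have hxy : x ≠ y := by
      rintro rfl
      have := hx l' (by rw [act_append, act_single, mul_assoc, g.sr_sr, mul_one])
      omega
    set w := act (l' ++ [y]) with hw
    -- minimal decomposition
    let P : ℕ → Prop := fun k => ∃ m u : List (Simp B S ⊤), (∀ z ∈ u, z = x ∨ z = y) ∧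
      w = act m * act u ∧ m.length + u.length = n ∧ m.length = k
    have hP : ∃ k, P k := ⟨l'.length, l', [y], by simp, by rw [hw, act_append], by simpa, rfl⟩
    classical
    obtain ⟨m, u, hu, hwmu, hmu, hmk⟩ := Nat.find_spec hP
    have hle : Nat.find hP ≤ l'.length :=
      Nat.find_min' hP ⟨l', [y], by simp, by rw [hw, act_append], by simpa, rfl⟩
    have hmn : m.length < n := by omega
    have hmred : ∀ m', act m' = act m → m.length ≤ m'.length := by
      intro m' hm'
      have := hred (m' ++ u) (by rw [act_append, hm', hwmu])
      rw [List.length_append] at this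
      omega
    have hms : ∀ z, (z = x ∨ z = y) → ∀ m', act m' = act m * sr z → m.length ≤ m'.length := by
      intro z hz m' hm'
      by_contra hlt
      push Not at hlt
      have e1 : w = act m' * act (z :: u) := by
        rw [hm', act_cons, mul_assoc, ← mul_assoc (sr z), g.sr_sr, one_mul, hwmu]
      have := hred (m' ++ (z :: u)) (by rw [act_append, e1])
      rw [List.length_append, List.length_cons] at this
      exact Nat.find_min hP (m := m'.length) (by omega) ⟨m', z :: u, by
        intro z' hz'
        rcases List.mem_cons.1 hz' with rfl | h
        · exact hz
        · exact hu _ h, e1, by rw [List.length_cons]; omega, rfl⟩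
    have hmx := IH m.length hmn m x rfl hmred (hms x (Or.inl rfl))
    have hmy := IH m.length hmn m y rfl hmred (hms y (Or.inr rfl))
    rcases g.dihedral hxy u hu with ⟨p, q, hp, hq, e⟩ | ⟨u', hlen', e⟩
    · rw [hwmu, Module.End.mul_apply, e, map_add, map_smul, map_smul]
      exact add_nonneg (smul_nonneg hp hmx) (smul_nonneg hq hmy)
    · exfalso
      have := hx (m ++ u') (by rw [act_append, ← e, hwmu, mul_assoc])
      rw [List.length_append] at this
      omega

theorem act_sign (g : Good B C S θ) (l : List (Simp B S ⊤)) (x : Simp B S ⊤) :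
    0 ≤ act l (ev x) ∨ 0 ≤ - act l (ev x) := by
  classical
  have h1 : ∃ n, ∃ l', act l' = act l ∧ l'.length = n := ⟨_, l, rfl, rfl⟩
  have h2 : ∃ n, ∃ l', act l' = act l * sr x ∧ l'.length = n :=
    ⟨_, l ++ [x], by rw [act_append, act_single], rfl⟩
  obtain ⟨l1, e1, n1⟩ := Nat.find_spec h1
  obtain ⟨l2, e2, n2⟩ := Nat.find_spec h2
  have m1 : ∀ l', act l' = act l → Nat.find h1 ≤ l'.length := fun l' h =>
    Nat.find_min' h1 ⟨l', h, rfl⟩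
  have m2 : ∀ l', act l' = act l * sr x → Nat.find h2 ≤ l'.length := fun l' h =>
    Nat.find_min' h2 ⟨l', h, rfl⟩
  have ess : act l * sr x * sr x = act l := by rw [mul_assoc, g.sr_sr, mul_one]
  rcases le_total (Nat.find h1) (Nat.find h2) with hle | hle
  · left
    have := g.humphreys _ l1 x n1 (by rw [e1]; exact m1)
      (by rw [e1]; exact fun l' h => hle.trans (m2 l' h))
    rwa [e1] at this
  · right
    have := g.humphreys _ l2 x n2 (by rw [e2]; exact m2)
      (by rw [e2, ess]; exact fun l' h => hle.trans (m1 l' h))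
    rwa [e2, Module.End.mul_apply, g.sr_ev, map_neg] at this

/-- lifted roots -/
def Rt (B : E →ₗ[ℝ] E →ₗ[ℝ] ℝ) (S : Set E) : Set (FM B S) := {u | ∃ l x, u = act l (ev x)}

theorem Rt_neg (g : Good B C S θ) {u : FM B S} (hu : u ∈ Rt B S) : -u ∈ Rt B S := by
  obtain ⟨l, x, rfl⟩ := hu
  exact ⟨l ++ [x], x, by rw [act_append, act_single, Module.End.mul_apply, g.sr_ev, map_neg]⟩

theorem Rt_act {u : FM B S} (hu : u ∈ Rt B S) (l : List (Simp B S ⊤)) : act l u ∈ Rt B S := by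
  obtain ⟨l', x, rfl⟩ := hu
  exact ⟨l ++ l', x, by rw [act_append, Module.End.mul_apply]⟩

theorem Rt_refl (g : Good B C S θ) {u v : FM B S} (hu : u ∈ Rt B S) (hv : v ∈ Rt B S) :
    v - (2 * B (pr B S u) (pr B S v)) • u ∈ Rt B S := by
  obtain ⟨l, x, rfl⟩ := hu
  have h1 := Rt_act hv (l ++ [x] ++ l.reverse)
  rw [act_append, act_append, act_single, Module.End.mul_apply, Module.End.mul_apply, sr_apply,
    map_sub, map_smul] at h1
  have h2 : act l (act l.reverse v) = v := by
    rw [← Module.End.mul_apply, g.act_reverse', Module.End.one_apply]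
  have h3 := g.B_act l (ev x) (act l.reverse v)
  rw [h2, pr_ev] at h3
  rwa [h2, ← h3] at h1

theorem pr_inj_aux (g : Good B C S θ) {v : FM B S} (hv : v ∈ Rt B S) {x : Simp B S ⊤}
    (h : pr B S v = x.1) : v = ev x := by
  classical
  have hpos : ∀ w : FM B S, 0 ≤ w → 0 ≤ θ (pr B S w) := by
    intro w hw
    rw [pr, Finsupp.linearCombination_apply, Finsupp.sum, map_sum]
    refine Finset.sum_nonneg fun i _ => ?_
    rw [map_smul]
    exact mul_nonneg (hw i) (g.pos _ i.2.1).le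
  have hv0 : 0 ≤ v := by
    obtain ⟨l, y, rfl⟩ := hv
    rcases g.act_sign l y with h1 | h1
    · exact h1
    · have := hpos _ h1
      rw [map_neg, h, map_neg] at this
      linarith [g.pos _ x.2.1]
  set w := v - ev x with hw
  have hwi : ∀ i, i ≠ x → 0 ≤ w i := by
    intro i hi
    have : w i = v i := by
      rw [hw, Finsupp.sub_apply, ev, Finsupp.single_apply, if_neg (Ne.symm hi), sub_zero]
    rw [this]; exact hv0 i
  have hw0 : pr B S w = 0 := by rw [hw, map_sub, h, pr_ev, sub_self]
  have hwsum : ∑ i ∈ w.support, w i • i.1 = 0 := by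
    rw [← hw0, pr, Finsupp.linearCombination_apply, Finsupp.sum]
  have hwx : 0 ≤ w x := by
    by_contra hneg
    push Not at hneg
    have h1 : B x.1 (∑ i ∈ w.support, w i • i.1) = 0 := by rw [hwsum, map_zero]
    rw [map_sum] at h1
    have h2 : ∀ i ∈ w.support, B x.1 (w i • i.1) ≤ 0 := by
      intro i _
      rw [map_smul, smul_eq_mul]
      by_cases hi : i = x
      · rw [hi, g.sys.unit _ x.2.1]; linarith
      · exact mul_nonpos_of_nonneg_of_nonpos (hwi i hi)
          (g.sys.obtuse x.2 i.2 fun e => hi (Subtype.ext e.symm))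
    have h3 := (Finset.sum_eq_zero_iff_of_nonpos h2).1 h1 x
      (Finsupp.mem_support_iff.2 hneg.ne)
    rw [map_smul, smul_eq_mul, g.sys.unit _ x.2.1] at h3
    linarith
  have hwall : ∀ i, 0 ≤ w i := fun i => by
    by_cases hi : i = x
    · rw [hi]; exact hwx
    · exact hwi i hi
  have h1 : θ (∑ i ∈ w.support, w i • i.1) = 0 := by rw [hwsum, map_zero]
  rw [map_sum] at h1
  have h2 : ∀ i ∈ w.support, 0 ≤ θ (w i • i.1) := by
    intro i _
    rw [map_smul]
    exact mul_nonneg (hwall i) (g.pos _ i.2.1).le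
  have h3 := (Finset.sum_eq_zero_iff_of_nonneg h2).1 h1
  have hw00 : w = 0 := by
    ext i
    by_contra hi
    have := h3 i (Finsupp.mem_support_iff.2 hi)
    rw [map_smul, smul_eq_mul] at this
    rcases mul_eq_zero.1 this with h4 | h4
    · exact hi h4
    · exact (g.pos _ i.2.1).ne' h4
  rw [hw, sub_eq_zero] at hw00
  exact hw00

theorem pr_inj (g : Good B C S θ) {u v : FM B S} (hu : u ∈ Rt B S) (hv : v ∈ Rt B S)
    (h : pr B S u = pr B S v) : u = v := by
  have hpl : ∀ (l : List (Simp B S ⊤)) (u v : FM B S), pr B S u = pr B S v →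
      pr B S (act l u) = pr B S (act l v) := by
    intro l
    induction l with
    | nil => intro u v h; simpa [act_nil] using h
    | cons x l ih =>
      intro u v h
      rw [act_cons, Module.End.mul_apply, Module.End.mul_apply, pr_sr, pr_sr, ih u v h]
  obtain ⟨l, x, rfl⟩ := hu
  have h1 := hpl l.reverse _ _ h
  rw [← Module.End.mul_apply, g.act_reverse, Module.End.one_apply, pr_ev] at h1
  have h2 := g.pr_inj_aux (Rt_act hv l.reverse) h1.symm
  rw [← h2, ← Module.End.mul_apply, g.act_reverse', Module.End.one_apply]

theorem pr_surj (g : Good B C S θ) {z : E} (hz : z ∈ S) : ∃ u ∈ Rt B S, pr B S u = z := by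
  refine g.induct ⊤ (P := fun z => ∃ u ∈ Rt B S, pr B S u = z) ?_ ?_ z hz trivial
  · intro x hx
    exact ⟨ev ⟨x, hx⟩, ⟨[], ⟨x, hx⟩, by simp [act_nil]⟩, pr_ev _⟩
  · rintro y x - - ⟨u, hu, rfl⟩ - - ⟨v, hv, rfl⟩ z - (rfl | rfl)
    · exact ⟨_, g.Rt_refl hu hv, by rw [map_sub, map_smul, rf]⟩
    · exact ⟨_, g.Rt_neg (g.Rt_refl hu hv), by rw [map_neg, map_sub, map_smul, rf]⟩

theorem pr_mem (g : Good B C S θ) {u : FM B S} (hu : u ∈ Rt B S) :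
    pr B S u ∈ S ∨ - pr B S u ∈ S := by
  obtain ⟨l, x, rfl⟩ := hu
  exact g.act_root l x

/-- rank two fullness lifts -/
theorem full_lift (g : Good B C S θ) {u v : FM B S} (hu : u ∈ Rt B S) (hv : v ∈ Rt B S)
    {z : E} (hz : z ∈ S) (hzs : z ∈ Submodule.span ℝ {pr B S u, pr B S v}) :
    ∃ w ∈ Rt B S, w ∈ Submodule.span ℝ {u, v} ∧ pr B S w = z := by
  -- a root proportional to `pr u`
  have hprop : ∀ u ∈ Rt B S, ∀ r : ℝ, z = r • pr B S u →
      ∃ w ∈ Rt B S, w ∈ Submodule.span ℝ {u} ∧ pr B S w = z := by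
    intro u hu r hr
    rcases g.pr_mem hu with h | h
    · exact ⟨u, hu, Submodule.mem_span_singleton_self u, (g.prop_eq hz h hr).symm⟩
    · refine ⟨-u, g.Rt_neg hu, Submodule.neg_mem _ (Submodule.mem_span_singleton_self u), ?_⟩
      rw [map_neg]
      exact (g.prop_eq hz h (r := -r) (by rw [hr, smul_neg, neg_smul, neg_neg])).symm
  by_cases hli : LinearIndependent ℝ ![pr B S u, pr B S v]
  · set T := Submodule.span ℝ {pr B S u, pr B S v} with hT
    obtain ⟨x1, x2, hx⟩ := g.simp_two (pr B S u) (pr B S v)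
    rw [← hT] at hx
    classical
    let lift : E → FM B S := fun z => if h : z ∈ S then (g.pr_surj h).choose else 0
    have hlift : ∀ z ∈ S, lift z ∈ Rt B S ∧ pr B S (lift z) = z := by
      intro z hz
      simp only [lift, dif_pos hz]
      exact (g.pr_surj hz).choose_spec
    set W := Submodule.span ℝ ({lift x1, lift x2} : Set (FM B S)) with hW
    have hWall : ∀ z ∈ S, z ∈ T → ∃ w ∈ Rt B S, w ∈ W ∧ pr B S w = z := by
      refine g.induct T (P := fun z => ∃ w ∈ Rt B S, w ∈ W ∧ pr B S w = z) ?_ ?_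
      · intro x hxs
        refine ⟨lift x, (hlift x hxs.1).1, ?_, (hlift x hxs.1).2⟩
        rcases hx hxs with rfl | h
        · exact Submodule.subset_span (by simp)
        · rw [mem_singleton_iff] at h; subst h
          exact Submodule.subset_span (by simp)
      · rintro y x - - ⟨u, hu, huW, rfl⟩ - - ⟨v, hv, hvW, rfl⟩ z - (rfl | rfl)
        · exact ⟨_, g.Rt_refl hu hv, W.sub_mem hvW (W.smul_mem _ huW), by
            rw [map_sub, map_smul, rf]⟩
        · exact ⟨_, g.Rt_neg (g.Rt_refl hu hv),
            W.neg_mem (W.sub_mem hvW (W.smul_mem _ huW)), by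
            rw [map_neg, map_sub, map_smul, rf]⟩
    have hmemW : ∀ u ∈ Rt B S, pr B S u ∈ T → u ∈ W := by
      intro u hu huT
      rcases g.pr_mem hu with h | h
      · obtain ⟨w, hw, hwW, e⟩ := hWall _ h huT
        rwa [← g.pr_inj hw hu e]
      · obtain ⟨w, hw, hwW, e⟩ := hWall _ h (T.neg_mem huT)
        have := g.pr_inj hw (g.Rt_neg hu) (by rw [e, map_neg])
        rw [this] at hwW
        simpa using hwW
    have huW := hmemW u hu (Submodule.subset_span (by simp))
    have hvW := hmemW v hv (Submodule.subset_span (by simp))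
    have hli' : LinearIndependent ℝ ![u, v] := by
      apply LinearIndependent.of_comp (pr B S)
      convert hli using 1
      ext i; fin_cases i <;> rfl
    have hfW : FiniteDimensional ℝ W := FiniteDimensional.span_of_finite ℝ (by simp)
    have h2 : Module.finrank ℝ W ≤ 2 := by
      have := finrank_span_finset_le_card (R := ℝ) ({lift x1, lift x2} : Finset (FM B S))
      have h3 : ({lift x1, lift x2} : Finset (FM B S)).card ≤ 2 := Finset.card_le_two
      simp only [Finset.coe_insert, Finset.coe_singleton] at this
      exact this.trans h3
    have h4 : Module.finrank ℝ (Submodule.span ℝ ({u, v} : Set (FM B S))) = 2 := by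
      have := finrank_span_eq_card hli'
      rw [Matrix.range_cons_cons_empty] at this
      simpa using this
    have h5 : Submodule.span ℝ ({u, v} : Set (FM B S)) = W := by
      apply Submodule.eq_of_le_of_finrank_le
      · rw [Submodule.span_le]
        rintro w (rfl | hw)
        · exact huW
        · rw [mem_singleton_iff] at hw; rw [hw]; exact hvW
      · omega
    obtain ⟨w, hw, hwW, e⟩ := hWall z hz hzs
    exact ⟨w, hw, h5 ▸ hwW, e⟩
  · -- proportional case
    have hu0 : pr B S u ≠ 0 := by
      rcases g.pr_mem hu with h | h
      · exact g.sys.ne_zero h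
      · exact neg_ne_zero.1 (g.sys.ne_zero h)
    rw [LinearIndependent.pair_iff' hu0] at hli
    push Not at hli
    obtain ⟨k, hk⟩ := hli
    obtain ⟨p, q, e⟩ := Submodule.mem_span_pair.1 hzs
    obtain ⟨w, hw, hwu, eww⟩ := hprop u hu (p + q * k) (by rw [← e, ← hk]; module)
    exact ⟨w, hw, Submodule.span_mono (by simp) hwu, eww⟩

/-- the main conclusion -/
theorem no_four (g : Good B C S θ) {α β γ : E} (hα : α ∈ S) (hβ : β ∈ S) (hγ : γ ∈ S)
    (hmin : ∀ G : Set E, α ∈ G → β ∈ G → γ ∈ G → (∀ δ ∈ G, ∀ ε ∈ G, ∀ ζ, (ζ ∈ S ∨ -ζ ∈ S) →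
      ζ ∈ Submodule.span ℝ {δ, ε} → ζ ∈ G) → S ⊆ G)
    {a b c d : E} (ha : a ∈ Simp B S ⊤) (hb : b ∈ Simp B S ⊤) (hc : c ∈ Simp B S ⊤)
    (hd : d ∈ Simp B S ⊤) (ab : a ≠ b) (ac : a ≠ c) (ad : a ≠ d) (bc : b ≠ c) (bd : b ≠ d)
    (cd : c ≠ d) : False := by
  obtain ⟨α', hα', rfl⟩ := g.pr_surj hα
  obtain ⟨β', hβ', rfl⟩ := g.pr_surj hβ
  obtain ⟨γ', hγ', rfl⟩ := g.pr_surj hγ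
  set T := Submodule.span ℝ ({α', β', γ'} : Set (FM B S)) with hT
  have hS := hmin {z | ∃ u ∈ Rt B S, u ∈ T ∧ pr B S u = z}
    ⟨α', hα', Submodule.subset_span (by simp), rfl⟩
    ⟨β', hβ', Submodule.subset_span (by simp), rfl⟩
    ⟨γ', hγ', Submodule.subset_span (by simp), rfl⟩ (by
      rintro δ ⟨u, hu, huT, rfl⟩ ε ⟨v, hv, hvT, rfl⟩ ζ hζ hspan
      have hle : Submodule.span ℝ ({u, v} : Set (FM B S)) ≤ T := by
        rw [Submodule.span_le]
        rintro w (rfl | hw)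
        · exact huT
        · rw [mem_singleton_iff] at hw; rw [hw]; exact hvT
      rcases hζ with hζ | hζ
      · obtain ⟨w, hw, hwT, e⟩ := g.full_lift hu hv hζ hspan
        exact ⟨w, hw, hle hwT, e⟩
      · obtain ⟨w, hw, hwT, e⟩ := g.full_lift hu hv hζ (Submodule.neg_mem _ hspan)
        exact ⟨-w, g.Rt_neg hw, T.neg_mem (hle hwT), by rw [map_neg, e, neg_neg]⟩)
  have hev : ∀ x : Simp B S ⊤, ev x ∈ T := by
    intro x
    obtain ⟨u, hu, huT, e⟩ := hS x.2.1
    rwa [← g.pr_inj_aux hu e]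
  have hfT : FiniteDimensional ℝ T := FiniteDimensional.span_of_finite ℝ (by simp)
  classical
  have h3 : Module.finrank ℝ T ≤ 3 := by
    have := finrank_span_finset_le_card (R := ℝ) ({α', β', γ'} : Finset (FM B S))
    have h3 : ({α', β', γ'} : Finset (FM B S)).card ≤ 3 := Finset.card_le_three
    simp only [Finset.coe_insert, Finset.coe_singleton] at this
    exact this.trans h3
  have hli0 : LinearIndependent ℝ (fun x : Simp B S ⊤ => (⟨ev x, hev x⟩ : T)) := by
    apply LinearIndependent.of_comp T.subtype
    exact Finsupp.linearIndependent_single_one ℝ _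
  let F : Finset (Simp B S ⊤) := {⟨a, ha⟩, ⟨b, hb⟩, ⟨c, hc⟩, ⟨d, hd⟩}
  have hF : F.card = 4 := by
    simp only [F]
    rw [Finset.card_insert_of_notMem, Finset.card_insert_of_notMem, Finset.card_insert_of_notMem,
      Finset.card_singleton]
    all_goals simp [ab, ac, ad, bc, bd, cd]
  have hli1 := hli0.comp (Subtype.val : F → Simp B S ⊤) Subtype.val_injective
  have := hli1.fintype_card_le_finrank
  rw [Fintype.card_coe, hF] at this
  omega

end Good

end RootCore

namespace RootCore

theorem core_normed {E : Type*} [NormedAddCommGroup E] [NormedSpace ℝ E] [FiniteDimensional ℝ E]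
    {B : E →ₗ[ℝ] E →ₗ[ℝ] ℝ} {C S : Set E} (h : Sys B C S) (hE : Module.finrank ℝ E ≤ 3)
    {α β γ : E} (hα : α ∈ S) (hβ : β ∈ S) (hγ : γ ∈ S)
    (hmin : ∀ G : Set E, α ∈ G → β ∈ G → γ ∈ G → (∀ δ ∈ G, ∀ ε ∈ G, ∀ ζ, (ζ ∈ S ∨ -ζ ∈ S) →
      ζ ∈ Submodule.span ℝ {δ, ε} → ζ ∈ G) → S ⊆ G) :
    (Simp B S ⊤).Finite ∧ (Simp B S ⊤).ncard ≤ 3 := by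
  by_contra hcon
  have h4 : ∃ t : Finset E, (↑t : Set E) ⊆ Simp B S ⊤ ∧ t.card = 4 := by
    by_cases hf : (Simp B S ⊤).Finite
    · have hn : 4 ≤ (Simp B S ⊤).ncard := by
        by_contra hlt
        exact hcon ⟨hf, by omega⟩
      rw [Set.ncard_eq_toFinset_card _ hf] at hn
      obtain ⟨t, ht, hc⟩ := Finset.exists_subset_card_eq hn
      exact ⟨t, fun x hx => by simpa using ht hx, hc⟩
    · obtain ⟨t, ht, hc⟩ := Set.Infinite.exists_subset_card_eq hf 4
      exact ⟨t, ht, hc⟩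
  obtain ⟨t, ht, hc⟩ := h4
  have hcn : t.card = 3 + 1 := hc
  classical
  obtain ⟨x, y, z, w, hxy, hxz, hxw, hyz, hyw, hzw, hts⟩ := Finset.card_eq_four.1 hc
  have hx : x ∈ Simp B S ⊤ := ht (by simp [hts])
  have hy : y ∈ Simp B S ⊤ := ht (by simp [hts])
  have hz : z ∈ Simp B S ⊤ := ht (by simp [hts])
  have hw : w ∈ Simp B S ⊤ := ht (by simp [hts])
  have hdep : ¬ LinearIndependent ℝ ![x, y, z, w] := by
    intro hli
    have := hli.fintype_card_le_finrank
    simp at this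
    omega
  rw [Fintype.not_linearIndependent_iff] at hdep
  obtain ⟨f, hf, i, hi⟩ := hdep
  simp only [Fin.sum_univ_four] at hf
  have h0 : ¬(f 0 = 0 ∧ f 1 = 0 ∧ f 2 = 0 ∧ f 3 = 0) := by
    rintro ⟨h0, h1, h2, h3⟩
    fin_cases i <;> simp_all
  obtain ⟨a, ha, b, hb, c, hc, d, hd, ab, ac, ad, bc, bd, cd, l, m, n, o, l0, m0, n0, o0, rel⟩ :=
    h.rel4 hx hy hz hw hxy hxz hxw hyz hyw hzw h0 hf
  have hli : LinearIndependent ℝ ![a, b, c] := by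
    rw [Fintype.linearIndependent_iff]
    intro k hk
    simp only [Fin.sum_univ_three] at hk
    obtain ⟨h1, h2, h3⟩ := h.rel3 ha.1 hb.1 hc.1 (h.obtuse ha hb ab) (h.obtuse ha hc ac)
      (h.obtuse hb hc bc) (p := k 0) (q := k 1) (r := k 2) hk
    intro i
    fin_cases i
    · exact h1
    · exact h2
    · exact h3
  have hspan : ∀ u, ∃ p q r s : ℝ, u = p • a + q • b + r • c + s • d := by
    intro u
    have htop := hli.span_eq_top_of_card_eq_finrank' (by
      have := hli.fintype_card_le_finrank
      simp at this ⊢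
      omega)
    have hu : u ∈ Submodule.span ℝ (Set.range ![a, b, c]) := by rw [htop]; trivial
    rw [Submodule.mem_span_range_iff_exists_fun] at hu
    obtain ⟨k, hk⟩ := hu
    refine ⟨k 0, k 1, k 2, 0, ?_⟩
    rw [← hk, Fin.sum_univ_three]
    simp
  have Q : Quad B S a b c d l m n o :=
    ⟨ha, hb, hc, hd, ab, ac, ad, bc, bd, cd, l0, m0, n0, o0, rel, hspan⟩
  obtain ⟨θ, hθ, hq⟩ := Q.exists_theta h
  have g : Good B C S θ := ⟨h, hθ, hq, Q.finite_sublevel h hθ hq⟩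
  exact g.no_four hα hβ hγ hmin ha hb hc hd ab ac ad bc bd cd

theorem core {E : Type*} [AddCommGroup E] [Module ℝ E] [FiniteDimensional ℝ E]
    {B : E →ₗ[ℝ] E →ₗ[ℝ] ℝ} {C S : Set E} (h : Sys B C S) (hE : Module.finrank ℝ E ≤ 3)
    {α β γ : E} (hα : α ∈ S) (hβ : β ∈ S) (hγ : γ ∈ S)
    (hmin : ∀ G : Set E, α ∈ G → β ∈ G → γ ∈ G → (∀ δ ∈ G, ∀ ε ∈ G, ∀ ζ, (ζ ∈ S ∨ -ζ ∈ S) →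
      ζ ∈ Submodule.span ℝ {δ, ε} → ζ ∈ G) → S ⊆ G) :
    (Simp B S ⊤).Finite ∧ (Simp B S ⊤).ncard ≤ 3 := by
  let e : E ≃ₗ[ℝ] (Fin (Module.finrank ℝ E) → ℝ) :=
    LinearEquiv.ofFinrankEq _ _ (by simp)
  letI i1 : NormedAddCommGroup E := NormedAddCommGroup.induced E _ e e.injective
  letI i2 : NormedSpace ℝ E := NormedSpace.induced ℝ E _ e
  exact core_normed (E := E) h hE hα hβ hγ hmin

end RootCore

namespace RootCore

theorem posSpan_add {A : Set V} {x y : V} (hx : x ∈ posSpan A) (hy : y ∈ posSpan A) :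
    x + y ∈ posSpan A := by
  classical
  obtain ⟨s, c, hs, hc, rfl⟩ := hx
  obtain ⟨t, d, ht, hd, rfl⟩ := hy
  refine ⟨s ∪ t, fun x => (if x ∈ s then c x else 0) + (if x ∈ t then d x else 0), ?_, ?_, ?_⟩
  · rw [Finset.coe_union]; exact union_subset hs ht
  · intro x _
    refine add_nonneg ?_ ?_
    · split_ifs with h
      · exact hc x h
      · exact le_rfl
    · split_ifs with h
      · exact hd x h
      · exact le_rfl
  · simp only [add_smul, Finset.sum_add_distrib, ite_smul, zero_smul, Finset.sum_ite_mem]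
    congr 1
    · rw [Finset.inter_eq_right.2 Finset.subset_union_left]
    · rw [Finset.inter_eq_right.2 Finset.subset_union_right]

theorem posSpan_smul {A : Set V} {x : V} (hx : x ∈ posSpan A) {r : ℝ} (hr : 0 ≤ r) :
    r • x ∈ posSpan A := by
  obtain ⟨s, c, hs, hc, rfl⟩ := hx
  refine ⟨s, fun x => r * c x, hs, fun x hx => mul_nonneg hr (hc x hx), ?_⟩
  rw [Finset.smul_sum]
  exact Finset.sum_congr rfl fun x _ => (mul_smul _ _ _).symm

theorem subset_posSpan {A : Set V} {x : V} (hx : x ∈ A) : x ∈ posSpan A :=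
  ⟨{x}, fun _ => 1, by simpa using hx, by simp, by simp⟩

theorem posSpan_pt (R : RootSystemData V) {x : V} (hx : x ∈ posSpan R.base)
    (hn : -x ∈ posSpan R.base) : x = 0 := by
  classical
  obtain ⟨s, c, hs, hc, e⟩ := hx
  by_contra h0
  have : ∃ b ∈ s, c b ≠ 0 := by
    by_contra hall
    push Not at hall
    exact h0 (e.trans (Finset.sum_eq_zero fun b hb => by rw [hall b hb, zero_smul]))
  obtain ⟨b, hb, hcb⟩ := this
  have hpos : 0 < c b := lt_of_le_of_ne (hc b hb) (Ne.symm hcb)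
  have h1 : ∑ y ∈ s.erase b, c y • y ∈ posSpan R.base :=
    ⟨s.erase b, c, fun y hy => hs (Finset.mem_of_mem_erase hy),
      fun y hy => hc y (Finset.mem_of_mem_erase hy), rfl⟩
  have h2 := posSpan_smul (posSpan_add hn h1) (inv_nonneg.2 hpos.le)
  have h3 : (c b)⁻¹ • (-x + ∑ y ∈ s.erase b, c y • y) = -b := by
    rw [e, ← Finset.add_sum_erase s _ hb, neg_add, add_assoc, neg_add_cancel, add_zero, smul_neg,
      smul_smul, inv_mul_cancel₀ hcb, one_smul]
  rw [h3] at h2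
  have h4 := R.pos_neg b (R.base_sub (hs hb))
  rcases h4 with ⟨_, h⟩ | ⟨_, h⟩
  · exact h h2
  · exact h (subset_posSpan (hs hb))

theorem Sys.prop_eq {E : Type*} [AddCommGroup E] [Module ℝ E] {B : E →ₗ[ℝ] E →ₗ[ℝ] ℝ}
    {C S : Set E} (h : Sys B C S) {x y : E} (hx : x ∈ S) (hy : y ∈ S) {r : ℝ}
    (e : x = r • y) : x = y := by
  have h5 := h.unit x hx
  rw [e] at h5
  simp only [map_smul, LinearMap.smul_apply, smul_eq_mul, h.unit y hy] at h5
  have : (r - 1) * (r + 1) = 0 := by linarith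
  rcases mul_eq_zero.1 this with h1 | h1
  · rw [e, show r = 1 by linarith, one_smul]
  · exfalso
    refine h.not_neg hy (h.sub (?_ : -y ∈ S))
    rw [show -y = x by rw [e, show r = -1 by linarith]; simp]
    exact hx

/-- the smallest full subsystem containing three given roots -/
def hull (R : RootSystemData V) (α β γ : V) : Set V :=
  {ζ | ζ ∈ R.Φ ∧ ∀ G : Set V, G ⊆ R.Φ → R.IsFullSub G → α ∈ G → β ∈ G → γ ∈ G → ζ ∈ G}

theorem hull_full (R : RootSystemData V) (α β γ : V) : R.IsFullSub (hull R α β γ) := by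
  rintro δ ⟨hδ, hδ'⟩ ε ⟨hε, hε'⟩ ζ ⟨hζ, hs⟩
  exact ⟨hζ, fun G hG hf ha hb hc =>
    hf δ (hδ' G hG hf ha hb hc) ε (hε' G hG hf ha hb hc) ⟨hζ, hs⟩⟩

theorem hull_sub (R : RootSystemData V) (α β γ : V) : R.IsSubsystem (hull R α β γ) := by
  refine ⟨fun ζ h => h.1, fun δ hδ ε hε => hull_full R α β γ δ hδ ε hε
    ⟨R.refl_mem δ hδ.1 ε hε.1, ?_⟩⟩
  exact Submodule.sub_mem _ (Submodule.subset_span (by simp))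
    (Submodule.smul_mem _ _ (Submodule.subset_span (by simp)))

theorem hull_neg (R : RootSystemData V) {α β γ ζ : V} (h : ζ ∈ hull R α β γ) :
    -ζ ∈ hull R α β γ := by
  have h1 := (hull_sub R α β γ).2 ζ h ζ h
  have h2 := R.pos_self ζ h.1
  rw [mul_div_assoc, div_self h2.ne'] at h1
  convert h1 using 1
  module

theorem hull_span (R : RootSystemData V) {α β γ ζ : V} (hα : α ∈ R.Φ) (hβ : β ∈ R.Φ)
    (hγ : γ ∈ R.Φ) (h : ζ ∈ hull R α β γ) : ζ ∈ Submodule.span ℝ ({α, β, γ} : Set V) := by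
  have := h.2 (R.Φ ∩ (Submodule.span ℝ ({α, β, γ} : Set V) : Set V)) inter_subset_left ?_
    ⟨hα, Submodule.subset_span (by simp)⟩ ⟨hβ, Submodule.subset_span (by simp)⟩
    ⟨hγ, Submodule.subset_span (by simp)⟩
  · exact this.2
  · rintro δ ⟨hδ, hδ'⟩ ε ⟨hε, hε'⟩ ζ ⟨hζ, hs⟩
    refine ⟨hζ, ?_⟩
    have hle : Submodule.span ℝ ({δ, ε} : Set V) ≤ Submodule.span ℝ ({α, β, γ} : Set V) := by
      rw [Submodule.span_le]
      rintro w (rfl | hw)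
      · exact hδ'
      · rw [mem_singleton_iff] at hw; rw [hw]; exact hε'
    exact hle hs

/-- normalized positive roots of `F` inside the subspace `U` -/
def nrm (R : RootSystemData V) (F : Set V) (U : Submodule ℝ V) : Set U :=
  {x | R.form x.1 x.1 = 1 ∧ x.1 ∈ posSpan R.base ∧ ∃ r : ℝ, 0 < r ∧ r • x.1 ∈ F}

theorem sys_nrm (R : RootSystemData V) {F : Set V} (U : Submodule ℝ V) (hF : R.IsSubsystem F)
    (hneg : ∀ ζ ∈ F, -ζ ∈ F) :
    Sys (R.form.domRestrict₁₂ U U) {x : U | x.1 ∈ posSpan R.base} (nrm R F U) where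
  symm x y := R.symm _ _
  cadd x hx y hy := posSpan_add hx hy
  csmul r hr x hx := posSpan_smul hx hr
  pt x hx hn := Subtype.ext (posSpan_pt R hx hn)
  sub x hx := hx.2.1
  unit x hx := hx.1
  refl x hx y hy := by
    set z : U := rf (R.form.domRestrict₁₂ U U) x y with hz
    have hz1 : R.form z.1 z.1 = 1 := by
      have := B_rf_rf (B := R.form.domRestrict₁₂ U U) (fun x y => R.symm _ _) hx.1 y y
      exact this.trans hy.1
    obtain ⟨hx1, hx2, r, hr, hrF⟩ := hx
    obtain ⟨hy1, hy2, s, hs, hsF⟩ := hy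
    have hzv : z.1 = y.1 - (2 * R.form x.1 y.1) • x.1 := rfl
    have hF' : s • z.1 ∈ F := by
      have := hF.2 _ hrF _ hsF
      convert this using 1
      rw [hzv]
      simp only [map_smul, LinearMap.smul_apply, smul_eq_mul, hx1, smul_sub, smul_smul]
      congr 2
      field_simp
    rcases R.pos_neg _ (hF.1 hF') with ⟨h, _⟩ | ⟨h, _⟩
    · left
      refine ⟨hz1, ?_, s, hs, hF'⟩
      have := posSpan_smul h (inv_nonneg.2 hs.le)
      rwa [smul_smul, inv_mul_cancel₀ hs.ne', one_smul] at this
    · right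
      refine ⟨?_, ?_, s, hs, ?_⟩
      · simpa using hz1
      · have := posSpan_smul h (inv_nonneg.2 hs.le)
        rwa [smul_neg, smul_smul, inv_mul_cancel₀ hs.ne', one_smul] at this
      · have := hneg _ hF'
        simpa using this

/-- the normalization map -/
noncomputable def nv (R : RootSystemData V) (x : V) : V := (√(R.form x x))⁻¹ • x

theorem nv_form (R : RootSystemData V) {x : V} (hx : x ∈ R.Φ) :
    R.form (nv R x) (nv R x) = 1 := by
  have h := R.pos_self x hx
  simp only [nv, map_smul, LinearMap.smul_apply, smul_eq_mul]
  have h1 := Real.sqrt_pos.2 h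
  have h2 := Real.mul_self_sqrt h.le
  field_simp
  nlinarith

theorem nv_pos (R : RootSystemData V) {x : V} (hx : x ∈ R.Φ) : 0 < (√(R.form x x))⁻¹ :=
  inv_pos.2 (Real.sqrt_pos.2 (R.pos_self x hx))

theorem nv_mem (R : RootSystemData V) {F : Set V} {U : Submodule ℝ V} (hF : F ⊆ R.Φ) {x : V}
    (hx : x ∈ F) (hp : x ∈ posSpan R.base) (hU : nv R x ∈ U) :
    (⟨nv R x, hU⟩ : U) ∈ nrm R F U := by
  refine ⟨nv_form R (hF hx), posSpan_smul hp (nv_pos R (hF hx)).le, √(R.form x x),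
    Real.sqrt_pos.2 (R.pos_self x (hF hx)), ?_⟩
  change √(R.form x x) • (√(R.form x x))⁻¹ • x ∈ F
  rw [smul_smul, mul_inv_cancel₀ (Real.sqrt_pos.2 (R.pos_self x (hF hx))).ne', one_smul]
  exact hx

theorem nv_inv (R : RootSystemData V) {x : V} (hx : x ∈ R.Φ) : x = √(R.form x x) • nv R x := by
  rw [nv, smul_smul, mul_inv_cancel₀ (Real.sqrt_pos.2 (R.pos_self x hx)).ne', one_smul]

theorem fund_simp (R : RootSystemData V) {F : Set V} {U : Submodule ℝ V} (hF : R.IsSubsystem F)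
    (hneg : ∀ ζ ∈ F, -ζ ∈ F) {x : V} (hx : x ∈ R.fund F) (hU : nv R x ∈ U) :
    (⟨nv R x, hU⟩ : U) ∈ Simp (R.form.domRestrict₁₂ U U) (nrm R F U) ⊤ := by
  obtain ⟨⟨hxF, hxP⟩, hxm⟩ := hx
  have hS := sys_nrm R U hF hneg
  set X : U := ⟨nv R x, hU⟩ with hX
  have hXS : X ∈ nrm R F U := nv_mem R hF.1 hxF hxP hU
  refine ⟨hXS, trivial, fun y hy _ hne => ?_⟩
  rcases hS.refl X hXS y hy with h | h
  · exact h
  exfalso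
  set y' : U := -(rf (R.form.domRestrict₁₂ U U) X y) with hy'
  have hne' : y' ≠ X := by
    intro e
    apply hne
    have h1 := rf_rf (B := R.form.domRestrict₁₂ U U) (x := X) hXS.1 y
    rw [← neg_neg (rf _ X y), ← hy', e, rf_neg, rf_self (x := X) hXS.1, neg_neg] at h1
    exact h1.symm
  set k := 2 * (R.form.domRestrict₁₂ U U) X y with hk
  have hsum : y + y' = k • X := by rw [hy', rf]; abel
  have hk0 : 0 < k := by
    by_contra hle
    push Not at hle
    have h1 : y + y' = 0 := by
      apply hS.pt _ (hS.cadd _ (hS.sub hy) _ (hS.sub h))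
      rw [hsum, ← neg_smul]
      exact hS.csmul _ (by linarith) _ (hS.sub hXS)
    apply hS.not_neg hy
    rw [neg_eq_of_add_eq_zero_right h1]
    exact hS.sub h
  have key : ∀ w ∈ nrm R F U, w ≠ X → w.1 ∈ posSpan ((F ∩ posSpan R.base) \ {x}) := by
    intro w hw hwX
    obtain ⟨h1, h2, r, hr, hrF⟩ := id hw
    have hm : r • w.1 ∈ (F ∩ posSpan R.base) \ {x} := by
      refine ⟨⟨hrF, posSpan_smul h2 hr.le⟩, ?_⟩
      intro e
      rw [mem_singleton_iff] at e
      apply hwX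
      refine hS.prop_eq hw hXS (r := r⁻¹ * √(R.form x x)) (Subtype.ext ?_)
      change w.1 = (r⁻¹ * √(R.form x x)) • nv R x
      rw [mul_smul, ← nv_inv R (hF.1 hxF), ← e, smul_smul, inv_mul_cancel₀ hr.ne', one_smul]
    have := posSpan_smul (subset_posSpan hm) (inv_nonneg.2 hr.le)
    rwa [smul_smul, inv_mul_cancel₀ hr.ne', one_smul] at this
  apply hxm
  have h1 := posSpan_smul (posSpan_add (key y hy hne) (key y' h hne'))
    (r := √(R.form x x) * k⁻¹) (mul_nonneg (Real.sqrt_nonneg _) (inv_nonneg.2 hk0.le))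
  have h2 : y.1 + y'.1 = k • nv R x := congrArg Subtype.val hsum
  rwa [h2, smul_smul, mul_assoc, inv_mul_cancel₀ hk0.ne', mul_one, ← nv_inv R (hF.1 hxF)] at h1

end RootCore

open RootCore

/-- Any three positive roots are contained in a full root subsystem of
rank at most 3. -/
theorem exists_full_subsystem_rank_le_three
    (R : RootSystemData V) (α β γ : V)
    (hα : α ∈ R.pos) (hβ : β ∈ R.pos) (hγ : γ ∈ R.pos) :
    ∃ F : Set V, R.IsSubsystem F ∧ R.IsFullSub F ∧ α ∈ F ∧ β ∈ F ∧ γ ∈ F ∧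
      (R.fund F).Finite ∧ (R.fund F).ncard ≤ 3 := by
  set F := hull R α β γ with hFd
  have hF : R.IsSubsystem F := hull_sub R α β γ
  have hfull : R.IsFullSub F := hull_full R α β γ
  have hneg : ∀ ζ ∈ F, -ζ ∈ F := fun ζ h => hull_neg R h
  have hαF : α ∈ F := ⟨hα.1, fun G _ _ h _ _ => h⟩
  have hβF : β ∈ F := ⟨hβ.1, fun G _ _ _ h _ => h⟩
  have hγF : γ ∈ F := ⟨hγ.1, fun G _ _ _ _ h => h⟩
  refine ⟨F, hF, hfull, hαF, hβF, hγF, ?_⟩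
  set U := Submodule.span ℝ ({α, β, γ} : Set V) with hU
  have hFU : ∀ ζ ∈ F, nv R ζ ∈ U := fun ζ h =>
    U.smul_mem _ (hull_span R hα.1 hβ.1 hγ.1 h)
  have hfin : FiniteDimensional ℝ U := FiniteDimensional.span_of_finite ℝ (by simp)
  have h3 : Module.finrank ℝ U ≤ 3 := by
    classical
    have := finrank_span_finset_le_card (R := ℝ) ({α, β, γ} : Finset V)
    have h3 : ({α, β, γ} : Finset V).card ≤ 3 := Finset.card_le_three
    simp only [Finset.coe_insert, Finset.coe_singleton] at this
    exact this.trans h3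
  have hS := sys_nrm R U hF hneg
  have hmain := core hS h3 (nv_mem R hF.1 hαF hα.2 (hFU α hαF))
    (nv_mem R hF.1 hβF hβ.2 (hFU β hβF)) (nv_mem R hF.1 hγF hγ.2 (hFU γ hγF)) (by
      intro G hαG hβG hγG hG x hx
      have hle : F ⊆ {ζ | ζ ∈ F ∧ ∃ r : ℝ, r ≠ 0 ∧ ∃ w ∈ G, w.1 = r • ζ} := by
        intro ζ hζ
        refine hζ.2 _ (fun z hz => hF.1 hz.1) ?_
          ⟨hαF, _, (nv_pos R hα.1).ne', _, hαG, rfl⟩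
          ⟨hβF, _, (nv_pos R hβ.1).ne', _, hβG, rfl⟩
          ⟨hγF, _, (nv_pos R hγ.1).ne', _, hγG, rfl⟩
        rintro δ ⟨hδ, r, hr, δ', hδ', e1⟩ ε ⟨hε, s, hs, ε', hε', e2⟩ ζ ⟨hζ, hsp⟩
        have hζF : ζ ∈ F := hfull δ hδ ε hε ⟨hζ, hsp⟩
        refine ⟨hζF, _, (nv_pos R hζ).ne', ⟨nv R ζ, hFU ζ hζF⟩, ?_, rfl⟩
        refine hG δ' hδ' ε' hε' _ ?_ ?_
        · rcases R.pos_neg ζ hζ with ⟨h, _⟩ | ⟨h, _⟩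
          · exact Or.inl (nv_mem R hF.1 hζF h _)
          · right
            have e : nv R (-ζ) = - nv R ζ := by simp [nv]
            have := nv_mem R hF.1 (hneg ζ hζF) h (hFU _ (hneg ζ hζF))
            convert this using 1
            exact Subtype.ext e.symm
        · obtain ⟨p, q, e⟩ := Submodule.mem_span_pair.1 hsp
          refine Submodule.mem_span_pair.2 ⟨(√(R.form ζ ζ))⁻¹ * p * r⁻¹,
            (√(R.form ζ ζ))⁻¹ * q * s⁻¹, Subtype.ext ?_⟩
          change ((√(R.form ζ ζ))⁻¹ * p * r⁻¹) • δ'.1 + ((√(R.form ζ ζ))⁻¹ * q * s⁻¹) • ε'.1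
            = (√(R.form ζ ζ))⁻¹ • ζ
          rw [e1, e2, smul_smul, smul_smul, mul_assoc, inv_mul_cancel₀ hr, mul_assoc _ s⁻¹,
            inv_mul_cancel₀ hs, mul_one, mul_one]
          rw [mul_smul, mul_smul, ← smul_add, e]
      obtain ⟨h1, h2, r, hr, hrF⟩ := id hx
      obtain ⟨_, t, ht, w, hw, e⟩ := hle hrF
      refine hG w hw w hw x (Or.inl hx) (Submodule.mem_span_pair.2 ⟨(t * r)⁻¹, 0, ?_⟩)
      apply Subtype.ext
      change (t * r)⁻¹ • w.1 + (0 : ℝ) • w.1 = x.1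
      rw [e, zero_smul, add_zero, smul_smul, smul_smul, mul_assoc,
        inv_mul_cancel₀ (mul_ne_zero ht hr.ne'), one_smul])
  obtain ⟨hfi, hca⟩ := hmain
  have hmaps : ∀ x ∈ R.fund F, nv R x ∈
      Subtype.val '' Simp (R.form.domRestrict₁₂ U U) (nrm R F U) ⊤ := fun x hx =>
    ⟨_, fund_simp R hF hneg hx (hFU x hx.1.1), rfl⟩
  have hinj : InjOn (nv R) (R.fund F) := by
    intro x hx y hy e
    have hxF := hF.1 hx.1.1
    have hyF := hF.1 hy.1.1
    have h1 : x = (√(R.form x x) * (√(R.form y y))⁻¹) • y := by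
      rw [mul_smul]
      exact (nv_inv R hxF).trans (by rw [e, nv])
    have hpos : 0 < √(R.form x x) * (√(R.form y y))⁻¹ :=
      mul_pos (Real.sqrt_pos.2 (R.pos_self x hxF)) (nv_pos R hyF)
    rcases R.reduced y hyF _ (h1 ▸ hxF) with h | h
    · rw [h1, h, one_smul]
    · linarith
  have hfi' := hfi.image (Subtype.val : U → V)
  exact ⟨Set.Finite.of_injOn hmaps hinj hfi',
    (Set.ncard_le_ncard_of_injOn _ hmaps hinj hfi').trans ((Set.ncard_image_le hfi).trans hca)⟩
end

section
/- If X is a finite or countable subset of V with a suitable ordering, then the poset of biclosed subsets of X under containment is a complete lattice, with join of a family given by the closure of the union and meet given by the interior of the intersection. -/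
open Set

variable {V : Type*} [AddCommGroup V] [Module ℝ V]

variable {V : Type*} [AddCommGroup V] [Module ℝ V]

/-- `Y` is a linear subset of `X`: the intersection of `X` with a linear subspace. -/
def IsLinearSubsetOf (X Y : Set V) : Prop := ∃ L : Submodule ℝ V, Y = X ∩ (L : Set V)

/-- `α` is a fundamental vector of `Y`. -/
def IsFundIn (Y : Set V) (α : V) : Prop := α ∈ Y ∧ α ∉ posSpan (Y \ {α})

/-- The index domain of an enumeration of length `N` (with `N = ⊤` for countably
infinite sets). -/
def domN (N : ℕ∞) : Set ℕ := {j | (j : ℕ∞) < N}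

/-- The whole set `X` enumerated by `g`. -/
def wholeSet (N : ℕ∞) (g : ℕ → V) : Set V := g '' domN N

/-- The initial segment `Xᵢ = {γ₁, ..., γᵢ}` of the enumeration. -/
def seg (N : ℕ∞) (g : ℕ → V) (i : ℕ) : Set V := g '' (domN N ∩ {j | j < i})

/-- The enumeration `g` (of length `N`) is a suitable ordering of
`X = wholeSet N g`: `g` is injective, `X` lies in an open half-space, every
2-dimensional linear subset of `X` has fundamental vectors which are ordered before
all other vectors of that subset, and every triple of vectors of an initial segment
`Xᵢ` lies in a full subset `F` of `X` with `F ∩ Xᵢ` clean. -/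
def SuitableEnum (N : ℕ∞) (g : ℕ → V) : Prop :=
  Set.InjOn g (domN N) ∧
  (∃ θ : Module.Dual ℝ V, ∀ x ∈ wholeSet N g, 0 < θ x) ∧
  (∀ Y : Set V, IsLinearSubsetOf (wholeSet N g) Y →
      Module.finrank ℝ (Submodule.span ℝ Y) = 2 →
      (∃ α β : V, IsFundIn Y α ∧ IsFundIn Y β ∧ Y ⊆ cone2 α β) ∧
      (∀ α β : V, IsFundIn Y α → β ∈ Y → ¬ IsFundIn Y β →
        ∀ a ∈ domN N, ∀ b ∈ domN N, g a = α → g b = β → a < b)) ∧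
  (∀ i : ℕ, ∀ α ∈ seg N g i, ∀ β ∈ seg N g i, ∀ γ ∈ seg N g i,
      ∃ F : Set V, IsFullIn (wholeSet N g) F ∧ α ∈ F ∧ β ∈ F ∧ γ ∈ F ∧
        IsCleanIn (F ∩ seg N g i))


lemma cone2_comm' {α β γ : V} (h : γ ∈ cone2 α β) : γ ∈ cone2 β α := by
  obtain ⟨a, b, ha, hb, h⟩ := h
  exact ⟨b, a, hb, ha, by rw [h, add_comm]⟩

lemma cone2_sub_posSpan {A : Set V} {α β γ : V} (hα : α ∈ A) (hβ : β ∈ A)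
    (h : γ ∈ cone2 α β) : γ ∈ posSpan A := by
  classical
  obtain ⟨a, b, ha, hb, h⟩ := h
  by_cases hab : α = β
  · subst hab
    refine ⟨{α}, fun _ => a + b, by simpa using hα, fun _ _ => by positivity, ?_⟩
    simp [h, add_smul]
  · refine ⟨{α, β}, fun x => if x = α then a else b, ?_, ?_, ?_⟩
    · intro x hx
      simp at hx
      rcases hx with rfl | rfl <;> assumption
    · intro x _
      dsimp only
      split_ifs <;> assumption
    · rw [Finset.sum_pair hab, h]
      simp [Ne.symm hab]

lemma closureIn_closed {X U : Set V} (hU : U ⊆ X) : IsClosedIn X (closureIn X U) := by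
  have hX : X ∈ {C | U ⊆ C ∧ IsClosedIn X C} := ⟨hU, Subset.rfl, fun _ _ _ _ _ h _ => h⟩
  refine ⟨sInter_subset_of_mem hX, ?_⟩
  intro α hα β hβ γ hγ h C hC
  exact hC.2.2 α (hα C hC) β (hβ C hC) γ hγ h

lemma subset_closureIn {X U : Set V} : U ⊆ closureIn X U := fun _ hx _ hC => hC.1 hx

lemma closureIn_min {X U C : Set V} (h : U ⊆ C) (hC : IsClosedIn X C) : closureIn X U ⊆ C :=
  sInter_subset_of_mem (⟨h, hC⟩ : C ∈ {C | U ⊆ C ∧ IsClosedIn X C})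

lemma compl_biclosed {X B : Set V} (h : IsBiclosedIn X B) : IsBiclosedIn X (X \ B) := by
  refine ⟨h.2, ?_⟩
  rw [sdiff_sdiff_cancel_left (show B ≤ X from h.1.1)]
  exact h.1

lemma seg_sub (N : ℕ∞) (g : ℕ → V) (i : ℕ) : seg N g i ⊆ wholeSet N g :=
  image_mono inter_subset_left

lemma seg_mono (N : ℕ∞) (g : ℕ → V) {i j : ℕ} (h : i ≤ j) : seg N g i ⊆ seg N g j :=
  image_mono fun _ hx => ⟨hx.1, lt_of_lt_of_le hx.2 h⟩

lemma seg_succ_mem {N : ℕ∞} {g : ℕ → V} {i : ℕ} (h : i ∈ domN N) :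
    seg N g (i + 1) = insert (g i) (seg N g i) := by
  ext x
  constructor
  · rintro ⟨j, ⟨hj, hj'⟩, rfl⟩
    rcases Nat.lt_succ_iff_lt_or_eq.1 hj' with h1 | rfl
    · exact Or.inr ⟨j, ⟨hj, h1⟩, rfl⟩
    · exact Or.inl rfl
  · rintro (rfl | ⟨j, ⟨hj, hj'⟩, rfl⟩)
    · exact ⟨i, ⟨h, Nat.lt_succ_self i⟩, rfl⟩
    · exact ⟨j, ⟨hj, Nat.lt_succ_of_lt hj'⟩, rfl⟩

lemma seg_succ_notMem {N : ℕ∞} {g : ℕ → V} {i : ℕ} (h : i ∉ domN N) :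
    seg N g (i + 1) = seg N g i := by
  refine Subset.antisymm ?_ (seg_mono N g (Nat.le_succ i))
  rintro _ ⟨j, ⟨hj, hj'⟩, rfl⟩
  rcases Nat.lt_succ_iff_lt_or_eq.1 hj' with h1 | rfl
  · exact ⟨j, ⟨hj, h1⟩, rfl⟩
  · exact absurd hj h

lemma exists_seg {N : ℕ∞} {g : ℕ → V} {x : V} (h : x ∈ wholeSet N g) : ∃ i, x ∈ seg N g i := by
  obtain ⟨j, hj, rfl⟩ := h
  exact ⟨j + 1, j, ⟨hj, Nat.lt_succ_self j⟩, rfl⟩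

lemma notMem_seg {N : ℕ∞} {g : ℕ → V} (hs : SuitableEnum N g) {i : ℕ} (h : i ∈ domN N) :
    g i ∉ seg N g i := by
  rintro ⟨j, ⟨hj, hj'⟩, h1⟩
  have := hs.1 hj h h1
  subst this
  exact absurd (show j < j from hj') (Nat.lt_irrefl j)

/-- The new vector cannot be forced both in and out. -/
lemma not_both {N : ℕ∞} {g : ℕ → V} (hs : SuitableEnum N g) {i : ℕ} {B : Set V}
    (hB : IsBiclosedIn (seg N g i) B) {γ α β α' β' : V} (hγ : γ ∈ wholeSet N g)
    (hα : α ∈ B) (hβ : β ∈ B) (hα' : α' ∈ seg N g i \ B) (hβ' : β' ∈ seg N g i \ B)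
    (h1 : γ ∈ cone2 α β) (h2 : γ ∈ cone2 α' β') : False := by
  obtain ⟨_, ⟨θ, hθ⟩, _, hF⟩ := hs
  obtain ⟨F, hFf, hαF, hβF, hαF', hclean⟩ := hF i α (hB.1.1 hα) β (hB.1.1 hβ) α' hα'.1
  have hγF : γ ∈ F := by
    refine hFf.2 α hαF β hβF ⟨hγ, ?_⟩
    obtain ⟨a, b, _, _, h⟩ := h1
    exact Submodule.mem_span_pair.2 ⟨a, b, h.symm⟩
  have h3 : ∃ β'' ∈ F ∩ (seg N g i \ B), γ ∈ cone2 α' β'' := by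
    obtain ⟨a, b, ha, hb, h⟩ := h2
    by_cases hb0 : b = 0
    · exact ⟨α', ⟨hαF', hα'⟩, a, 0, ha, le_rfl, by simp [h, hb0]⟩
    · refine ⟨β', ⟨?_, hβ'⟩, a, b, ha, hb, h⟩
      refine hFf.2 γ hγF α' hαF' ⟨seg_sub _ _ _ hβ'.1, ?_⟩
      refine Submodule.mem_span_pair.2 ⟨b⁻¹, - (b⁻¹ * a), ?_⟩
      rw [h, smul_add, smul_smul, smul_smul, inv_mul_cancel₀ hb0, neg_smul, one_smul]
      abel
  obtain ⟨β'', ⟨hβF', hβ''⟩, h3⟩ := h3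
  have hbi : IsBiclosedIn (F ∩ seg N g i) (F ∩ B) := by
    refine ⟨⟨inter_subset_inter_right _ hB.1.1, ?_⟩, sdiff_subset, ?_⟩
    · intro x hx y hy z hz hc
      exact ⟨hz.1, hB.1.2 x hx.2 y hy.2 z hz.2 hc⟩
    · intro x hx y hy z hz hc
      refine ⟨hz, fun hz' => ?_⟩
      exact (hB.2.2 x ⟨hx.1.2, fun h => hx.2 ⟨hx.1.1, h⟩⟩ y
        ⟨hy.1.2, fun h => hy.2 ⟨hy.1.1, h⟩⟩ z hz.2 hc).2 hz'.2
  have hw := (hclean _ hbi).2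
  have hm : γ ∈ posSpan (F ∩ B) ∩ posSpan ((F ∩ seg N g i) \ (F ∩ B)) :=
    ⟨cone2_sub_posSpan ⟨hαF, hα⟩ ⟨hβF, hβ⟩ h1,
     cone2_sub_posSpan ⟨⟨hαF', hα'.1⟩, fun h => hα'.2 h.2⟩
       ⟨⟨hβF', hβ''.1⟩, fun h => hβ''.2 h.2⟩ h3⟩
  rw [hw] at hm
  have h0 := hθ γ hγ
  rw [mem_singleton_iff.1 hm, map_zero] at h0
  exact lt_irrefl _ h0

/-- Plane geometry: `α, γ, ε, δ, β` in this order. -/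
lemma plane_aux {α β γ δ ε : V} {p q r s a b : ℝ} (hp : 0 ≤ p) (hq : 0 ≤ q)
    (hr : 0 ≤ r) (hs : 0 ≤ s) (ha : 0 ≤ a) (hb : 0 ≤ b)
    (hγ : γ = p • α + q • β) (hδ : δ = r • α + s • β) (hε : ε = a • γ + b • δ)
    (hε0 : ε ≠ 0) (hD : 0 < p * s - q * r) : ε ∈ cone2 α δ ∧ γ ∈ cone2 α ε := by
  have hs0 : 0 < s := by
    rcases hs.eq_or_lt with h | h
    · subst h
      nlinarith [mul_nonneg hq hr]
    · exact h
  constructor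
  · refine ⟨a * (p * s - q * r) / s, a * q / s + b, by positivity, by positivity, ?_⟩
    rw [hε, hγ, hδ]
    match_scalars <;> field_simp <;> ring
  · by_cases hb0 : b = 0
    · have ha0 : a ≠ 0 := by
        rintro rfl
        apply hε0
        simp [hε, hb0]
      refine ⟨0, a⁻¹, le_rfl, by positivity, ?_⟩
      rw [hε, hb0]
      simp [smul_smul, inv_mul_cancel₀ ha0]
    · have hb' : 0 < b := lt_of_le_of_ne hb (Ne.symm hb0)
      have hpos : 0 < a * q + b * s := by positivity
      refine ⟨b * (p * s - q * r) / (a * q + b * s), q / (a * q + b * s),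
        by positivity, by positivity, ?_⟩
      rw [hε, hγ, hδ]
      match_scalars <;> field_simp <;> ring

lemma ext_key {N : ℕ∞} {g : ℕ → V} (hs : SuitableEnum N g) {i : ℕ} (hi : i ∈ domN N)
    {B : Set V} (hB : IsBiclosedIn (seg N g i) B)
    (hout : ∀ α ∈ seg N g i \ B, ∀ β ∈ seg N g i \ B, g i ∉ cone2 α β)
    {δ ε : V} (hδ : δ ∈ B) (hε : ε ∈ seg N g i) (hc : ε ∈ cone2 (g i) δ) : ε ∈ B := by
  by_contra hεB
  have hns := notMem_seg hs hi
  obtain ⟨_, ⟨θ, hθ⟩, hY, _⟩ := hs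
  set γ := g i with hγdef
  have hδS := hB.1.1 hδ
  have hγX : γ ∈ wholeSet N g := ⟨i, hi, rfl⟩
  have hδX := seg_sub _ _ _ hδS
  have hεX := seg_sub _ _ _ hε
  have nz : ∀ x ∈ wholeSet N g, x ≠ 0 := by
    rintro x hx rfl
    have := hθ _ hx
    simp at this
  have hc' := hc
  obtain ⟨a, b, ha, hb, hεe⟩ := hc
  have hpar : ∀ t : ℝ, t • δ ≠ γ := by
    intro t ht
    apply hεB
    refine hB.1.2 δ hδ δ hδ ε hε ⟨a * t + b, 0, ?_, le_rfl, ?_⟩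
    · have h1 : 0 < θ γ := hθ _ hγX
      have h2 : 0 < θ δ := hθ _ hδX
      rw [← ht, map_smul, smul_eq_mul] at h1
      have := pos_of_mul_pos_left h1 h2.le
      positivity
    · rw [hεe, ← ht, smul_smul, add_smul, zero_smul, add_zero]
  have hli : LinearIndependent ℝ ![δ, γ] := (LinearIndependent.pair_iff' (nz _ hδX)).2 hpar
  set L : Submodule ℝ V := Submodule.span ℝ {δ, γ} with hL
  have hδL : δ ∈ L := Submodule.subset_span (by simp)
  have hγL : γ ∈ L := Submodule.subset_span (by simp)
  have hεL : ε ∈ L := by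
    rw [hεe]
    exact L.add_mem (L.smul_mem _ hγL) (L.smul_mem _ hδL)
  have hspan : Submodule.span ℝ (wholeSet N g ∩ (L : Set V)) = L := by
    apply le_antisymm
    · exact Submodule.span_le.2 inter_subset_right
    · rw [hL]
      apply Submodule.span_mono
      rintro x (rfl | rfl)
      · exact ⟨hδX, hδL⟩
      · exact ⟨hγX, hγL⟩
  have hrank : Module.finrank ℝ (Submodule.span ℝ (wholeSet N g ∩ (L : Set V))) = 2 := by
    rw [hspan]
    have := finrank_span_eq_card hli
    rw [Matrix.range_cons_cons_empty] at this
    simpa using this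
  obtain ⟨⟨α, β, hα, hβ, hcone⟩, hord⟩ := hY _ ⟨L, rfl⟩ hrank
  have hεγ : γ ≠ ε := fun h => hns (h ▸ hε)
  have hεδ : δ ≠ ε := fun h => hεB (h ▸ hδ)
  have hεnf : ¬ IsFundIn (wholeSet N g ∩ (L : Set V)) ε := fun h =>
    h.2 (cone2_sub_posSpan ⟨⟨hγX, hγL⟩, hεγ⟩ ⟨⟨hδX, hδL⟩, hεδ⟩ hc')
  have hγnf : ¬ IsFundIn (wholeSet N g ∩ (L : Set V)) γ := by
    intro h
    obtain ⟨j, ⟨hj, hj'⟩, hje⟩ := hε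
    have := hord γ ε h ⟨hεX, hεL⟩ hεnf i hi j hj rfl hje
    exact absurd hj' (not_lt.2 this.le)
  have hfS : ∀ x, IsFundIn (wholeSet N g ∩ (L : Set V)) x → x ∈ seg N g i := by
    intro x hx
    obtain ⟨j, hj, hje⟩ := hx.1.1
    exact ⟨j, ⟨hj, hord x γ hx ⟨hγX, hγL⟩ hγnf j hj i hi hje rfl⟩, hje⟩
  obtain ⟨p, q, hp, hq, hγe⟩ := hcone ⟨hγX, hγL⟩
  obtain ⟨r, s, hr, hs', hδe⟩ := hcone ⟨hδX, hδL⟩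
  have fin : ∀ x ∈ seg N g i, ε ∈ cone2 x δ ∧ γ ∈ cone2 x ε → False := by
    intro x hx h
    by_cases hxB : x ∈ B
    · exact hεB (hB.1.2 x hxB δ hδ ε hε h.1)
    · exact hout x ⟨hx, hxB⟩ ε ⟨hε, hεB⟩ h.2
  rcases lt_trichotomy (p * s - q * r) 0 with hD | hD | hD
  · exact fin β (hfS β hβ) (plane_aux hq hp hs' hr ha hb (by rw [hγe, add_comm])
      (by rw [hδe, add_comm]) hεe (nz _ hεX) (by linarith))
  · have e1 : s • γ = q • δ := by
      rw [hγe, hδe]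
      match_scalars <;> linarith
    have e2 : r • γ = p • δ := by
      rw [hγe, hδe]
      match_scalars <;> linarith
    by_cases hs0 : s = 0
    · by_cases hr0 : r = 0
      · apply nz _ hδX
        simp [hδe, hs0, hr0]
      · apply hpar (r⁻¹ * p)
        rw [← smul_smul, ← e2, smul_smul, inv_mul_cancel₀ hr0, one_smul]
    · apply hpar (s⁻¹ * q)
      rw [← smul_smul, ← e1, smul_smul, inv_mul_cancel₀ hs0, one_smul]
  · exact fin α (hfS α hα) (plane_aux hp hq hr hs' ha hb hγe hδe hεe (nz _ hεX) hD)

lemma ext_in {N : ℕ∞} {g : ℕ → V} (hs : SuitableEnum N g) {i : ℕ} (hi : i ∈ domN N)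
    {B : Set V} (hB : IsBiclosedIn (seg N g i) B)
    (hout : ∀ α ∈ seg N g i \ B, ∀ β ∈ seg N g i \ B, g i ∉ cone2 α β) :
    IsBiclosedIn (seg N g (i + 1)) (insert (g i) B) := by
  have hns := notMem_seg hs hi
  rw [seg_succ_mem hi]
  constructor
  · refine ⟨insert_subset_insert hB.1.1, ?_⟩
    rintro α hα β hβ ε (rfl | hε) hc
    · exact Or.inl rfl
    right
    rcases hα with rfl | hα
    · rcases hβ with rfl | hβ
      · by_contra hεB
        obtain ⟨a, b, ha, hb, h⟩ := hc
        obtain ⟨θ, hθ⟩ := hs.2.1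
        have h0 : a + b ≠ 0 := by
          intro h0
          have := hθ _ (seg_sub _ _ _ hε)
          rw [h, ← add_smul, h0, zero_smul, map_zero] at this
          exact lt_irrefl _ this
        refine hout ε ⟨hε, hεB⟩ ε ⟨hε, hεB⟩ ⟨(a + b)⁻¹, 0, by positivity, le_rfl, ?_⟩
        rw [h, ← add_smul a b, smul_smul, inv_mul_cancel₀ h0]
        simp
      · exact ext_key hs hi hB hout hβ hε hc
    · rcases hβ with rfl | hβ
      · exact ext_key hs hi hB hout hα hε (cone2_comm' hc)
      · exact hB.1.2 α hα β hβ ε hε hc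
  · have he : insert (g i) (seg N g i) \ insert (g i) B = seg N g i \ B := by
      ext x
      constructor
      · rintro ⟨h1 | h1, h2⟩
        · exact absurd (Or.inl h1) h2
        · exact ⟨h1, fun h => h2 (Or.inr h)⟩
      · rintro ⟨h1, h2⟩
        refine ⟨Or.inr h1, ?_⟩
        rintro (rfl | h)
        · exact hns h1
        · exact h2 h
    rw [he]
    refine ⟨fun x hx => Or.inr hx.1, ?_⟩
    rintro α hα β hβ ε (rfl | hε) hc
    · exact absurd hc (hout α hα β hβ)
    · exact hB.2.2 α hα β hβ ε hε hc

lemma ext_out {N : ℕ∞} {g : ℕ → V} (hs : SuitableEnum N g) {i : ℕ} (hi : i ∈ domN N)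
    {B : Set V} (hB : IsBiclosedIn (seg N g i) B)
    (hin : ∀ α ∈ B, ∀ β ∈ B, g i ∉ cone2 α β) :
    IsBiclosedIn (seg N g (i + 1)) B := by
  have hns := notMem_seg hs hi
  have h := compl_biclosed (ext_in hs hi (compl_biclosed hB)
    (by rwa [sdiff_sdiff_cancel_left (show B ≤ seg N g i from hB.1.1)]))
  have he : seg N g (i + 1) \ insert (g i) (seg N g i \ B) = B := by
    rw [seg_succ_mem hi]
    ext x
    constructor
    · rintro ⟨h1, h2⟩
      by_contra hx
      rcases h1 with h1 | h1
      · exact h2 (Or.inl h1)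
      · exact h2 (Or.inr ⟨h1, hx⟩)
    · intro hx
      refine ⟨Or.inr (hB.1.1 hx), ?_⟩
      rintro (rfl | h)
      · exact hns (hB.1.1 hx)
      · exact h.2 hx
  rwa [he] at h

/-- The inductive step. -/
lemma join_step {N : ℕ∞} {g : ℕ → V} (hs : SuitableEnum N g)
    (𝒳 : Set (Set V)) (h𝒳 : ∀ B ∈ 𝒳, IsBiclosedIn (wholeSet N g) B) (i : ℕ)
    (hJ : IsBiclosedIn (seg N g i) (closureIn (seg N g i) (⋃₀ 𝒳 ∩ seg N g i))) :
    IsBiclosedIn (seg N g (i + 1)) (closureIn (seg N g (i + 1)) (⋃₀ 𝒳 ∩ seg N g (i + 1))) ∧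
    closureIn (seg N g (i + 1)) (⋃₀ 𝒳 ∩ seg N g (i + 1)) ∩ seg N g i =
      closureIn (seg N g i) (⋃₀ 𝒳 ∩ seg N g i) := by
  by_cases hi : i ∈ domN N
  swap
  · rw [seg_succ_notMem hi]
    exact ⟨hJ, inter_eq_left.2 hJ.1.1⟩
  have hns := notMem_seg hs hi
  have hγX : g i ∈ wholeSet N g := ⟨i, hi, rfl⟩
  set J := closureIn (seg N g i) (⋃₀ 𝒳 ∩ seg N g i) with hJdef
  set J' := closureIn (seg N g (i + 1)) (⋃₀ 𝒳 ∩ seg N g (i + 1)) with hJ'def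
  have hsub : seg N g i ⊆ seg N g (i + 1) := seg_mono N g (Nat.le_succ i)
  have hUJ : ⋃₀ 𝒳 ∩ seg N g i ⊆ J := subset_closureIn
  have hUJ' : ⋃₀ 𝒳 ∩ seg N g (i + 1) ⊆ J' := subset_closureIn
  have hJ'c : IsClosedIn (seg N g (i + 1)) J' := closureIn_closed inter_subset_right
  have hJJ' : J ⊆ J' := by
    have : J ⊆ J' ∩ seg N g i := by
      apply closureIn_min
      · exact fun x hx => ⟨hUJ' ⟨hx.1, hsub hx.2⟩, hx.2⟩
      · exact ⟨inter_subset_right, fun α hα β hβ γ hγ hc =>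
          ⟨hJ'c.2 α hα.1 β hβ.1 γ (hsub hγ) hc, hγ⟩⟩
    exact fun x hx => (this hx).1
  have hγS : g i ∈ seg N g (i + 1) := by
    rw [seg_succ_mem hi]
    exact Or.inl rfl
  suffices hK : ∃ K, IsBiclosedIn (seg N g (i + 1)) K ∧ K ∩ seg N g i = J ∧
      ⋃₀ 𝒳 ∩ seg N g (i + 1) ⊆ K ∧ K ⊆ J' by
    obtain ⟨K, h1, h2, h3, h4⟩ := hK
    have : J' = K := Subset.antisymm (closureIn_min h3 h1.1) h4
    rw [this]
    exact ⟨h1, h2⟩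
  have hins : insert (g i) J ∩ seg N g i = J := by
    ext x
    constructor
    · rintro ⟨rfl | h, h2⟩
      · exact absurd h2 hns
      · exact h
    · exact fun h => ⟨Or.inr h, hJ.1.1 h⟩
  have hUins : ⋃₀ 𝒳 ∩ seg N g (i + 1) ⊆ insert (g i) J := by
    rw [seg_succ_mem hi]
    rintro x ⟨hx, rfl | h⟩
    · exact Or.inl rfl
    · exact Or.inr (hUJ ⟨hx, h⟩)
  by_cases hin : ∃ α ∈ J, ∃ β ∈ J, g i ∈ cone2 α β
  · obtain ⟨α, hα, β, hβ, hc⟩ := hin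
    refine ⟨insert (g i) J, ext_in hs hi hJ ?_, hins, hUins, insert_subset ?_ hJJ'⟩
    · exact fun α' hα' β' hβ' hc' => not_both hs hJ hγX hα hβ hα' hβ' hc hc'
    · exact hJ'c.2 α (hJJ' hα) β (hJJ' hβ) _ hγS hc
  · push Not at hin
    by_cases hU : g i ∈ ⋃₀ 𝒳
    · refine ⟨insert (g i) J, ext_in hs hi hJ ?_, hins, hUins,
        insert_subset (hUJ' ⟨hU, hγS⟩) hJJ'⟩
      intro α hα β hβ hc
      obtain ⟨B, hB, hγB⟩ := hU
      have key : ∀ x ∈ seg N g i \ J, x ∈ wholeSet N g \ B := fun x hx =>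
        ⟨seg_sub _ _ _ hx.1, fun h => hx.2 (hUJ ⟨⟨B, hB, h⟩, hx.1⟩)⟩
      exact ((h𝒳 B hB).2.2 α (key α hα) β (key β hβ) _ hγX hc).2 hγB
    · refine ⟨J, ext_out hs hi hJ hin, inter_eq_left.2 hJ.1.1, ?_, hJJ'⟩
      intro x hx
      rcases hUins hx with rfl | h
      · exact absurd hx.1 hU
      · exact h

lemma join_biclosed {N : ℕ∞} {g : ℕ → V} (hs : SuitableEnum N g)
    (𝒳 : Set (Set V)) (h𝒳 : ∀ B ∈ 𝒳, IsBiclosedIn (wholeSet N g) B) :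
    IsBiclosedIn (wholeSet N g) (closureIn (wholeSet N g) (⋃₀ 𝒳)) := by
  set J : ℕ → Set V := fun i => closureIn (seg N g i) (⋃₀ 𝒳 ∩ seg N g i) with hJdef
  have hUX : ⋃₀ 𝒳 ⊆ wholeSet N g := sUnion_subset fun B hB => (h𝒳 B hB).1.1
  have hJ : ∀ i, IsBiclosedIn (seg N g i) (J i) := by
    intro i
    induction i with
    | zero =>
      have h0 : seg N g 0 = ∅ := by simp [seg]
      have h1 : J 0 ⊆ ∅ := by
        have := (closureIn_closed (X := seg N g 0) (U := ⋃₀ 𝒳 ∩ seg N g 0) inter_subset_right).1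
        intro x hx
        exact h0 ▸ this hx
      rw [subset_empty_iff.1 h1, h0]
      simp [IsBiclosedIn, IsClosedIn]
    | succ i ih => exact (join_step hs 𝒳 h𝒳 i ih).1
  have hstep : ∀ i, J (i + 1) ∩ seg N g i = J i := fun i => (join_step hs 𝒳 h𝒳 i (hJ i)).2
  have hres : ∀ i j, i ≤ j → J j ∩ seg N g i = J i := by
    intro i j hij
    induction j, hij using Nat.le_induction with
    | base => exact inter_eq_left.2 (hJ i).1.1
    | succ j hij ih =>
      rw [← ih, ← hstep j, inter_assoc, inter_eq_right.2 (seg_mono N g hij)]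
  have hmono : ∀ i j, i ≤ j → J i ⊆ J j := fun i j hij => by
    rw [← hres i j hij]
    exact inter_subset_left
  have hmem : ∀ i x, x ∈ seg N g i → x ∈ ⋃ j, J j → x ∈ J i := by
    intro i x hx hxW
    obtain ⟨j, hj⟩ := mem_iUnion.1 hxW
    rw [← hres i (max i j) (le_max_left _ _)]
    exact ⟨hmono _ _ (le_max_right _ _) hj, hx⟩
  have hcommon : ∀ x ∈ wholeSet N g, ∀ y ∈ wholeSet N g, ∀ z ∈ wholeSet N g,
      ∃ k, x ∈ seg N g k ∧ y ∈ seg N g k ∧ z ∈ seg N g k := by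
    intro x hx y hy z hz
    obtain ⟨a, ha⟩ := exists_seg hx
    obtain ⟨b, hb⟩ := exists_seg hy
    obtain ⟨c, hc⟩ := exists_seg hz
    exact ⟨a + b + c, seg_mono N g (by omega) ha, seg_mono N g (by omega) hb,
      seg_mono N g (by omega) hc⟩
  have hWX : (⋃ j, J j) ⊆ wholeSet N g :=
    iUnion_subset fun j => (hJ j).1.1.trans (seg_sub _ _ _)
  have hW : IsBiclosedIn (wholeSet N g) (⋃ j, J j) := by
    refine ⟨⟨hWX, ?_⟩, sdiff_subset, ?_⟩
    · intro x hx y hy z hz hc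
      obtain ⟨k, h1, h2, h3⟩ := hcommon x (hWX hx) y (hWX hy) z hz
      exact mem_iUnion.2 ⟨k, (hJ k).1.2 x (hmem k x h1 hx) y (hmem k y h2 hy) z h3 hc⟩
    · intro x hx y hy z hz hc
      obtain ⟨k, h1, h2, h3⟩ := hcommon x hx.1 y hy.1 z hz
      refine ⟨hz, fun hzW => ?_⟩
      exact ((hJ k).2.2 x ⟨h1, fun h => hx.2 (mem_iUnion.2 ⟨k, h⟩)⟩ y
        ⟨h2, fun h => hy.2 (mem_iUnion.2 ⟨k, h⟩)⟩ z h3 hc).2 (hmem k z h3 hzW)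
  have hcl := closureIn_closed hUX
  have heq : closureIn (wholeSet N g) (⋃₀ 𝒳) = ⋃ j, J j := by
    apply Subset.antisymm
    · apply closureIn_min _ hW.1
      intro x hx
      obtain ⟨k, hk⟩ := exists_seg (hUX hx)
      exact mem_iUnion.2 ⟨k, subset_closureIn ⟨hx, hk⟩⟩
    · apply iUnion_subset
      intro j
      have : J j ⊆ closureIn (wholeSet N g) (⋃₀ 𝒳) ∩ seg N g j := by
        apply closureIn_min
        · exact fun x hx => ⟨subset_closureIn hx.1, hx.2⟩
        · exact ⟨inter_subset_right, fun α hα β hβ γ hγ hc =>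
            ⟨hcl.2 α hα.1 β hβ.1 γ (seg_sub _ _ _ hγ) hc, hγ⟩⟩
      exact fun x hx => (this hx).1
  rw [heq]
  exact hW

/-- If `X` has a suitable ordering, the biclosed subsets of `X` form a
complete lattice under containment: for any family `𝒳` of biclosed sets, the closure
of the union is the least upper bound and the interior of the intersection is the
greatest lower bound. -/
theorem biclosed_completeLattice
    (N : ℕ∞) (g : ℕ → V) (hs : SuitableEnum N g)
    (𝒳 : Set (Set V)) (h𝒳 : ∀ B ∈ 𝒳, IsBiclosedIn (wholeSet N g) B) :
    (IsBiclosedIn (wholeSet N g) (closureIn (wholeSet N g) (⋃₀ 𝒳)) ∧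
      (∀ B ∈ 𝒳, B ⊆ closureIn (wholeSet N g) (⋃₀ 𝒳)) ∧
      (∀ C : Set V, IsBiclosedIn (wholeSet N g) C → (∀ B ∈ 𝒳, B ⊆ C) →
        closureIn (wholeSet N g) (⋃₀ 𝒳) ⊆ C)) ∧
    (IsBiclosedIn (wholeSet N g) (interiorIn (wholeSet N g) (wholeSet N g ∩ ⋂₀ 𝒳)) ∧
      (∀ B ∈ 𝒳, interiorIn (wholeSet N g) (wholeSet N g ∩ ⋂₀ 𝒳) ⊆ B) ∧
      (∀ C : Set V, IsBiclosedIn (wholeSet N g) C → (∀ B ∈ 𝒳, C ⊆ B) →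
        C ⊆ interiorIn (wholeSet N g) (wholeSet N g ∩ ⋂₀ 𝒳))) := by
  refine ⟨⟨join_biclosed hs 𝒳 h𝒳, fun B hB => (subset_sUnion_of_mem hB).trans subset_closureIn,
    fun C hC h => closureIn_min (sUnion_subset h) hC.1⟩, ?_⟩
  set X := wholeSet N g with hX
  have hu : X \ (X ∩ ⋂₀ 𝒳) = ⋃₀ ((fun B => X \ B) '' 𝒳) := by
    ext x
    constructor
    · rintro ⟨hx, hn⟩
      have : ¬ ∀ B ∈ 𝒳, x ∈ B := fun h => hn ⟨hx, h⟩
      push Not at this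
      obtain ⟨B, hB, hxB⟩ := this
      exact ⟨X \ B, ⟨B, hB, rfl⟩, hx, hxB⟩
    · rintro ⟨_, ⟨B, hB, rfl⟩, hx, hxB⟩
      exact ⟨hx, fun h => hxB (h.2 B hB)⟩
  unfold interiorIn
  rw [hu]
  refine ⟨?_, ?_, ?_⟩
  · apply compl_biclosed
    apply join_biclosed hs
    rintro _ ⟨B, hB, rfl⟩
    exact compl_biclosed (h𝒳 B hB)
  · rintro B hB x ⟨hx, hn⟩
    by_contra hxB
    exact hn (subset_closureIn ⟨X \ B, ⟨B, hB, rfl⟩, hx, hxB⟩)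
  · intro C hC h x hx
    refine ⟨hC.1.1 hx, fun hx' => ?_⟩
    refine (closureIn_min ?_ hC.2 hx').2 hx
    rintro y ⟨_, ⟨B, hB, rfl⟩, hy, hyB⟩
    exact ⟨hy, fun hyC => hyB (h B hB hyC)⟩
end
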